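/- arXiv:0911.0915 — 7 statements merged into one kernel-verified Lean document; each statement's English description precedes it below -/
import Mathlib

section
/- For every ξ ∈ (0,1) and every r ∈ ℝ, the integral ∫_ℝ (1 − cos(k r)) |k|^{−(2+ξ)} dk converges and equals √π |Γ(−(1+ξ)/2)| / (2^{1+ξ} Γ(1+ξ/2)) · |r|^{1+ξ}. -/
open MeasureTheory Real

lemma aux_fub {μ ν : Measure ℝ} [SFinite μ] [SFinite ν] (f : ℝ × ℝ → ℝ) (hf : Measurable f)
    (g h : ℝ → ℝ) (h0 : ∀ᵐ y ∂ν, ∀ᵐ x ∂μ, 0 ≤ f (x, y))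
    (hg : ∀ᵐ x ∂μ, ∫ y, f (x, y) ∂ν = g x)
    (hi : ∀ᵐ y ∂ν, Integrable (fun x => f (x, y)) μ)
    (hh : ∀ᵐ y ∂ν, ∫ x, f (x, y) ∂μ = h y) (hint : Integrable h ν) :
    Integrable g μ ∧ ∫ x, g x ∂μ = ∫ y, h y ∂ν := by
  have key : Integrable f (μ.prod ν) := by
    rw [integrable_prod_iff' hf.aestronglyMeasurable]
    refine ⟨hi, hint.congr ?_⟩
    filter_upwards [h0, hh] with y h0 hh
    rw [← hh]
    apply integral_congr_ae
    filter_upwards [h0] with x hx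
    rw [Real.norm_of_nonneg hx]
  refine ⟨key.integral_prod_left.congr hg, ?_⟩
  rw [← integral_congr_ae hg, ← integral_congr_ae hh]
  exact integral_integral_swap (f := fun x y => f (x, y)) key

lemma aux_exp (s c : ℝ) (hs0 : 0 < s) (hs1 : s < 1) (hc : 0 ≤ c) :
    IntegrableOn (fun u : ℝ => u ^ (-s - 1) * (1 - Real.exp (-(c * u)))) (Set.Ioi 0) ∧
    ∫ u in Set.Ioi (0 : ℝ), u ^ (-s - 1) * (1 - Real.exp (-(c * u))) =
      Real.Gamma (1 - s) * c ^ s / s := by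
  have hint : IntegrableOn (fun y : ℝ => y ^ (s - 1)) (Set.Ioc 0 c) :=
    (intervalIntegrable_iff_integrableOn_Ioc_of_le hc).1
      (intervalIntegral.intervalIntegrable_rpow' (by linarith))
  have h := aux_fub (μ := volume.restrict (Set.Ioi 0)) (ν := volume.restrict (Set.Ioc 0 c))
    (fun p => p.1 ^ (-s) * Real.exp (-(p.2 * p.1))) (by fun_prop)
    (fun u : ℝ => u ^ (-s - 1) * (1 - Real.exp (-(c * u))))
    (fun y => Real.Gamma (1 - s) * y ^ (s - 1)) ?_ ?_ ?_ ?_ (hint.const_mul _)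
  · refine ⟨h.1, h.2.trans ?_⟩
    rw [integral_const_mul, ← intervalIntegral.integral_of_le hc,
      integral_rpow (Or.inl (by linarith))]
    simp [Real.zero_rpow hs0.ne']
    ring
  · refine Filter.Eventually.of_forall fun y => ?_
    filter_upwards [ae_restrict_mem measurableSet_Ioi] with x hx
    have : (0 : ℝ) < x := hx
    positivity
  · filter_upwards [ae_restrict_mem measurableSet_Ioi] with x hx
    have hx : (0 : ℝ) < x := hx
    rw [integral_const_mul, ← intervalIntegral.integral_of_le hc]
    have : ∀ y ∈ Set.uIcc 0 c, HasDerivAt (fun y : ℝ => -Real.exp (-(y * x)) / x)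
        (Real.exp (-(y * x))) y := by
      intro y _
      have := ((((hasDerivAt_id y).mul_const x).neg.exp).neg).div_const x
      refine HasDerivAt.congr_deriv (f := fun y : ℝ => -Real.exp (-(y * x)) / x) this ?_
      simp [hx.ne']
    rw [intervalIntegral.integral_eq_sub_of_hasDerivAt this
      (Continuous.intervalIntegrable (by fun_prop) _ _), Real.rpow_sub_one hx.ne']
    simp
    field_simp
    ring
  · filter_upwards [ae_restrict_mem measurableSet_Ioc] with y hy
    have := integrableOn_rpow_mul_exp_neg_mul_rpow (p := 1) (s := -s) (by linarith) one_pos hy.1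
    simpa [IntegrableOn] using this
  · filter_upwards [ae_restrict_mem measurableSet_Ioc] with y hy
    have := Real.integral_rpow_mul_exp_neg_mul_Ioi (a := 1 - s) (by linarith) hy.1
    rw [show 1 - s - 1 = -s by ring] at this
    rw [this, one_div, Real.inv_rpow hy.1.le, ← Real.rpow_neg hy.1.le, neg_sub, mul_comm]

lemma aux_inv (s c : ℝ) (hs0 : 0 < s) (hs1 : s < 1) (hc : 0 ≤ c) :
    IntegrableOn (fun u : ℝ => u ^ (s - 1) * (1 - Real.exp (-(c / u)))) (Set.Ioi 0) ∧
    ∫ u in Set.Ioi (0 : ℝ), u ^ (s - 1) * (1 - Real.exp (-(c / u))) =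
      Real.Gamma (1 - s) * c ^ s / s := by
  obtain ⟨h1, h2⟩ := aux_exp s c hs0 hs1 hc
  have e : Set.EqOn (fun x : ℝ => (|(-1 : ℝ)| * x ^ ((-1 : ℝ) - 1)) •
      ((x ^ (-1 : ℝ)) ^ (-s - 1) * (1 - Real.exp (-(c * x ^ (-1 : ℝ))))))
      (fun u : ℝ => u ^ (s - 1) * (1 - Real.exp (-(c / u)))) (Set.Ioi 0) := by
    intro x hx
    have hx : (0 : ℝ) < x := hx
    simp only [smul_eq_mul, abs_neg, abs_one, one_mul]
    rw [← mul_assoc, ← Real.rpow_mul hx.le, ← Real.rpow_add hx, Real.rpow_neg_one, div_eq_mul_inv]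
    congr 2
    ring
  constructor
  · rw [← integrableOn_Ioi_comp_rpow_iff _ (p := -1) (by norm_num)] at h1
    exact h1.congr_fun e measurableSet_Ioi
  · rw [← setIntegral_congr_fun measurableSet_Ioi e, ← h2]
    exact integral_comp_rpow_Ioi
      (fun u : ℝ => u ^ (-s - 1) * (1 - Real.exp (-(c * u)))) (by norm_num)

lemma aux_gauss (r t : ℝ) (ht : 0 < t) :
    Integrable (fun k : ℝ => (1 - Real.cos (k * r)) * Real.exp (-(k ^ 2 * t))) ∧
    ∫ k : ℝ, (1 - Real.cos (k * r)) * Real.exp (-(k ^ 2 * t)) =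
      Real.sqrt (π / t) * (1 - Real.exp (-(r ^ 2 / 4 / t))) := by
  have hG : Integrable (fun k : ℝ => Real.exp (-(k ^ 2 * t))) := by
    convert integrable_exp_neg_mul_sq ht using 3
    ring
  have hG2 : ∫ k : ℝ, Real.exp (-(k ^ 2 * t)) = Real.sqrt (π / t) := by
    rw [← integral_gaussian]
    congr 1; ext k; congr 1; ring
  have hb : 0 < (t : ℂ).re := by simpa using ht
  have hF := fourierIntegral_gaussian hb (r : ℂ)
  have hI : Integrable (fun x : ℝ =>
      Complex.exp (Complex.I * r * x) * Complex.exp (-(t : ℂ) * x ^ 2)) := by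
    convert integrable_cexp_quadratic hb (Complex.I * r) 0 using 2
    rw [← Complex.exp_add]; congr 1; ring
  have hre : ∀ x : ℝ, RCLike.re (Complex.exp (Complex.I * r * x) *
      Complex.exp (-(t : ℂ) * x ^ 2)) = Real.cos (x * r) * Real.exp (-(x ^ 2 * t)) := by
    intro x
    have e1 : Complex.I * r * x = ((x * r : ℝ) : ℂ) * Complex.I := by push_cast; ring
    have e2 : -(t : ℂ) * x ^ 2 = ((-(x ^ 2 * t) : ℝ) : ℂ) := by push_cast; ring
    rw [e1, e2, ← Complex.ofReal_exp, RCLike.re_to_complex, Complex.re_mul_ofReal,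
      Complex.exp_ofReal_mul_I_re]
  have hC : Integrable (fun k : ℝ => Real.cos (k * r) * Real.exp (-(k ^ 2 * t))) := by
    have := hI.re
    simpa only [hre] using this
  have hC2 : ∫ k : ℝ, Real.cos (k * r) * Real.exp (-(k ^ 2 * t)) =
      Real.sqrt (π / t) * Real.exp (-(r ^ 2 / 4 / t)) := by
    have := integral_re hI
    simp only [hre] at this
    rw [this, hF]
    have e1 : ((π : ℂ) / t) ^ (1 / 2 : ℂ) = ((Real.sqrt (π / t) : ℝ) : ℂ) := by
      rw [Real.sqrt_eq_rpow, Complex.ofReal_cpow (by positivity)]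
      push_cast; rfl
    have e2 : -(r : ℂ) ^ 2 / (4 * t) = ((-(r ^ 2 / 4 / t) : ℝ) : ℂ) := by
      push_cast; rw [div_div]; ring
    rw [e1, e2, ← Complex.ofReal_exp, ← Complex.ofReal_mul]
    exact Complex.ofReal_re _
  simp only [sub_mul, one_mul]
  refine ⟨hG.sub hC, ?_⟩
  rw [integral_sub hG hC, hG2, hC2]
  ring

/-- For `ξ ∈ (0,1)` and `r ∈ ℝ`, the integral `∫_ℝ (1 − cos(kr)) |k|^{−(2+ξ)} dk` converges and
equals `√π |Γ(−(1+ξ)/2)| / (2^{1+ξ} Γ(1+ξ/2)) · |r|^{1+ξ}`. -/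
theorem stmt_4 (ξ r : ℝ) (hξ : ξ ∈ Set.Ioo (0 : ℝ) 1) :
    Integrable (fun k : ℝ => (1 - Real.cos (k * r)) * |k| ^ (-(2 + ξ))) ∧
    ∫ k : ℝ, (1 - Real.cos (k * r)) * |k| ^ (-(2 + ξ)) =
      Real.sqrt π * |Real.Gamma (-(1 + ξ) / 2)| / ((2 : ℝ) ^ (1 + ξ) * Real.Gamma (1 + ξ / 2)) *
        |r| ^ (1 + ξ) := by
  obtain ⟨h0, h1⟩ := hξ
  have hΓ : 0 < Real.Gamma (1 + ξ / 2) := Real.Gamma_pos_of_pos (by linarith)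
  obtain ⟨i1, i2⟩ := aux_inv ((1 + ξ) / 2) (r ^ 2 / 4) (by linarith) (by linarith) (by positivity)
  have h := aux_fub (μ := volume) (ν := volume.restrict (Set.Ioi 0))
    (fun p => (1 - Real.cos (p.1 * r)) * (p.2 ^ (ξ / 2) * Real.exp (-(p.1 ^ 2 * p.2))))
    (by fun_prop)
    (fun k => ((1 - Real.cos (k * r)) * |k| ^ (-(2 + ξ))) * Real.Gamma (1 + ξ / 2))
    (fun t => Real.sqrt π * (t ^ ((1 + ξ) / 2 - 1) * (1 - Real.exp (-(r ^ 2 / 4 / t)))))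
    ?_ ?_ ?_ ?_ (i1.const_mul _)
  · obtain ⟨a, b⟩ := h
    rw [integral_const_mul, i2, integral_mul_const] at b
    refine ⟨?_, ?_⟩
    · exact (integrable_mul_const_iff (IsUnit.mk0 _ hΓ.ne') _).1 a
    · rw [eq_div_of_mul_eq hΓ.ne' b]
      have hg : Real.Gamma (1 - (1 + ξ) / 2) = -((1 + ξ) / 2) * Real.Gamma (-(1 + ξ) / 2) := by
        rw [← neg_div, ← Real.Gamma_add_one (by linarith)]
        congr 1; ring
      have hp : 0 < Real.Gamma (1 - (1 + ξ) / 2) := Real.Gamma_pos_of_pos (by linarith)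
      have hn : Real.Gamma (-(1 + ξ) / 2) < 0 := by
        rw [hg] at hp; nlinarith
      have hc : (r ^ 2 / 4) ^ ((1 + ξ) / 2) = |r| ^ (1 + ξ) / 2 ^ (1 + ξ) := by
        rw [show r ^ 2 / 4 = (|r| / 2) ^ (2 : ℝ) by
          rw [Real.rpow_two, div_pow, sq_abs]; norm_num, ← Real.rpow_mul (by positivity),
          Real.div_rpow (by positivity) (by positivity)]
        congr 2 <;> ring
      rw [abs_of_neg hn, hg, hc]
      have : (1 + ξ) ≠ 0 := by linarith
      have : (2 : ℝ) ^ (1 + ξ) ≠ 0 := by positivity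
      field_simp
  · filter_upwards [ae_restrict_mem measurableSet_Ioi] with t ht
    have ht : (0 : ℝ) < t := ht
    refine Filter.Eventually.of_forall fun k => ?_
    have : 0 ≤ 1 - Real.cos (k * r) := by linarith [Real.cos_le_one (k * r)]
    positivity
  · have : ∀ᵐ k : ℝ, k ≠ 0 := by simp [ae_iff]
    filter_upwards [this] with k hk
    have hk2 : 0 < k ^ 2 := by positivity
    have := Real.integral_rpow_mul_exp_neg_mul_Ioi (a := 1 + ξ / 2) (by linarith) hk2
    rw [add_sub_cancel_left] at this
    rw [integral_const_mul, this, mul_assoc]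
    congr 2
    rw [one_div, Real.inv_rpow hk2.le, ← Real.rpow_neg hk2.le, ← sq_abs, ← Real.rpow_two,
      ← Real.rpow_mul (abs_nonneg _)]
    congr 1; ring
  · filter_upwards [ae_restrict_mem measurableSet_Ioi] with t ht
    refine ((aux_gauss r t ht).1.const_mul (t ^ (ξ / 2))).congr (Filter.Eventually.of_forall fun k => ?_)
    simp only
    ring
  · filter_upwards [ae_restrict_mem measurableSet_Ioi] with t ht
    have ht' : (0 : ℝ) < t := ht
    have : ∀ k : ℝ, (1 - Real.cos (k * r)) * (t ^ (ξ / 2) * Real.exp (-(k ^ 2 * t))) =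
      t ^ (ξ / 2) * ((1 - Real.cos (k * r)) * Real.exp (-(k ^ 2 * t))) := fun k => by ring
    simp only [this]
    rw [integral_const_mul, (aux_gauss r t ht).2, Real.sqrt_div Real.pi_pos.le,
      show (1 + ξ) / 2 - 1 = ξ / 2 - 1 / 2 by ring, Real.rpow_sub ht', ← Real.sqrt_eq_rpow]
    ring
end

section
/- Let d > d' ≥ 2 be integers and ℘ ∈ [0,1]. Set ℘' = ℘(d−1)/(℘(d−d') + d'−1) and 𝒦 = 1 + ℘(d−d')/(d'−1). Then ℘' ∈ [0,1], and for every nonzero k' ∈ ℝ^{d'}, writing k = (k',0) ∈ ℝ^d for the embedding of k' with d−d' trailing zero components, one has for all α,β ∈ {1,…,d'}: (1−℘)δ_{αβ} + (℘d−1) k'_α k'_β/‖k'‖² = 𝒦 [ (1−℘')δ_{αβ} + (℘'d'−1) k'_α k'_β/‖k'‖² ]. Moreover, for d' = 1 and ℘ > 0, the (1,1) entry satisfies (1−℘) + (℘d−1) = ℘(d−1). -/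
/-- Let `d > d' ≥ 2` be integers and `℘ ∈ [0,1]`.  With
`℘' = ℘(d−1)/(℘(d−d') + d'−1)` and `𝒦 = 1 + ℘(d−d')/(d'−1)`, one has `℘' ∈ [0,1]`, and for every
nonzero `k' ∈ ℝ^{d'}` (identified with its embedding `k = (k',0) ∈ ℝ^d`, which has the same
components and the same norm) and all `α, β ∈ {1,…,d'}`:
`(1−℘)δ_{αβ} + (℘d−1) k'_α k'_β/‖k'‖² = 𝒦 [ (1−℘')δ_{αβ} + (℘'d'−1) k'_α k'_β/‖k'‖² ]`.
Moreover, for `d' = 1` and `℘ > 0`, the `(1,1)` entry satisfies `(1−℘) + (℘d−1) = ℘(d−1)`. -/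
theorem stmt_6 (d d' : ℕ) (hdd' : d' < d) (hd' : 2 ≤ d') (p : ℝ) (hp : p ∈ Set.Icc (0 : ℝ) 1) :
    p * ((d : ℝ) - 1) / (p * ((d : ℝ) - (d' : ℝ)) + (d' : ℝ) - 1) ∈ Set.Icc (0 : ℝ) 1 ∧
    (∀ k' : EuclideanSpace ℝ (Fin d'), k' ≠ 0 → ∀ α β : Fin d',
      (1 - p) * (if α = β then (1 : ℝ) else 0) + (p * (d : ℝ) - 1) * (k' α * k' β) / ‖k'‖ ^ 2 =
        (1 + p * ((d : ℝ) - (d' : ℝ)) / ((d' : ℝ) - 1)) *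
          ((1 - p * ((d : ℝ) - 1) / (p * ((d : ℝ) - (d' : ℝ)) + (d' : ℝ) - 1)) *
              (if α = β then (1 : ℝ) else 0) +
            (p * ((d : ℝ) - 1) / (p * ((d : ℝ) - (d' : ℝ)) + (d' : ℝ) - 1) * (d' : ℝ) - 1) *
              (k' α * k' β) / ‖k'‖ ^ 2)) ∧
    (0 < p → (1 - p) + (p * (d : ℝ) - 1) = p * ((d : ℝ) - 1)) := by
  obtain ⟨hp0, hp1⟩ := hp
  have h1 : (2 : ℝ) ≤ (d' : ℝ) := by exact_mod_cast hd'
  have h2 : (d' : ℝ) < (d : ℝ) := by exact_mod_cast hdd'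
  have hm : 0 ≤ p * ((d : ℝ) - (d' : ℝ)) := mul_nonneg hp0 (by linarith)
  have hD : 0 < p * ((d : ℝ) - (d' : ℝ)) + (d' : ℝ) - 1 := by linarith
  have hE : (d' : ℝ) - 1 ≠ 0 := by linarith
  refine ⟨⟨div_nonneg (mul_nonneg hp0 (by linarith)) hD.le, ?_⟩, ?_, ?_⟩
  · rw [div_le_one hD]
    nlinarith [mul_nonneg (sub_nonneg.2 hp1) (by linarith : (0 : ℝ) ≤ (d' : ℝ) - 1)]
  · intro k' _ α β
    have hDne := hD.ne'
    have e1 : (1 + p * ((d : ℝ) - (d' : ℝ)) / ((d' : ℝ) - 1)) *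
        (1 - p * ((d : ℝ) - 1) / (p * ((d : ℝ) - (d' : ℝ)) + (d' : ℝ) - 1)) = 1 - p := by
      field_simp
      ring
    have e2 : (1 + p * ((d : ℝ) - (d' : ℝ)) / ((d' : ℝ) - 1)) *
        (p * ((d : ℝ) - 1) / (p * ((d : ℝ) - (d' : ℝ)) + (d' : ℝ) - 1) * (d' : ℝ) - 1)
          = p * (d : ℝ) - 1 := by
      field_simp
      ring
    rw [← e1, ← e2]
    ring
  · intro _
    ring
end

section
/- Fix ξ ∈ (0,1), ℘ ∈ [0,1], and L > 0. For every r = (r₁,r₂) ∈ ℝ² and every α,β ∈ {1,2}, the sum over j ∈ ℤ of the integrals ∫_ℝ |1 − cos(k₁ r₁ + (j/L) r₂)| · |A_{αβ}((k₁, j/L);℘)| · (k₁² + j²/L²)^{−(2+ξ)/2} dk₁ is finite (each integral converging absolutely, including the j = 0 term where the integrand is |1 − cos(k₁ r₁)|·|A_{αβ}((k₁,0);℘)|·|k₁|^{−(2+ξ)}). Hence the function d_{αβ}(r) = (1/(4π²L)) ∑_{j∈ℤ} ∫_ℝ (1 − cos(k₁ r₁ + (j/L) r₂)) A_{αβ}((k₁,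 j/L);℘) (k₁² + j²/L²)^{−(2+ξ)/2} dk₁ is well defined and continuous on ℝ². -/
open MeasureTheory Real

/-- The matrix `A_{αβ}(k;℘) = (1−℘)δ_{αβ} + (2℘−1) k_α k_β/‖k‖²` for `k = (k₁,k₂) ∈ ℝ²`. -/
noncomputable def Acyl (p k₁ k₂ : ℝ) (α β : Fin 2) : ℝ :=
  (1 - p) * (if α = β then 1 else 0) +
    (2 * p - 1) * (![k₁, k₂] α * ![k₁, k₂] β) / (k₁ ^ 2 + k₂ ^ 2)

/-- The spatial covariance of velocity differences of the Kraichnan model on the cylinder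
(in the limit of infinite correlation length):
`d_{αβ}(r) = (1/(4π²L)) ∑_{j∈ℤ} ∫_ℝ (1 − cos(k₁r₁ + (j/L)r₂)) A_{αβ}((k₁, j/L);℘)
(k₁² + j²/L²)^{−(2+ξ)/2} dk₁`. -/
noncomputable def dcov (p ξ L : ℝ) (α β : Fin 2) (r : ℝ × ℝ) : ℝ :=
  1 / (4 * π ^ 2 * L) * ∑' j : ℤ, ∫ k₁ : ℝ,
    (1 - Real.cos (k₁ * r.1 + (j : ℝ) / L * r.2)) * Acyl p k₁ ((j : ℝ) / L) α β *
      (k₁ ^ 2 + (j : ℝ) ^ 2 / L ^ 2) ^ (-(2 + ξ) / 2)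


lemma integrable_W (m r : ℝ) (hm : 0 < m) (hr : 1 < r) :
    Integrable (fun k : ℝ => (m * (1 + k ^ 2)) ^ (-r / 2)) := by
  have h := integrable_rpow_neg_one_add_norm_sq (E := ℝ) (μ := volume) (r := r) (by simpa using hr)
  refine (h.const_mul (m ^ (-r / 2))).congr (Filter.Eventually.of_forall fun k => ?_)
  simp only [Real.norm_eq_abs, sq_abs]
  rw [Real.mul_rpow hm.le (by positivity)]

lemma integrable_near (ξ : ℝ) (h : ξ < 1) :
    Integrable ((Set.Icc (-1 : ℝ) 1).indicator (fun k => |k| ^ (-ξ))) := by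
  rw [integrable_indicator_iff measurableSet_Icc]
  have h1 : IntervalIntegrable (fun k : ℝ => |k| ^ (-ξ)) volume 0 1 := by
    refine (intervalIntegral.intervalIntegrable_rpow' (a := 0) (b := 1) (r := -ξ)
      (by linarith)).congr ?_
    intro x hx
    rw [Set.uIoc_of_le zero_le_one] at hx
    simp only [abs_of_pos hx.1]
  have h2 : IntervalIntegrable (fun k : ℝ => |k| ^ (-ξ)) volume (-1) 0 := by
    rw [IntervalIntegrable.iff_comp_neg]
    simpa using h1.symm
  have h3 := h2.trans h1
  rwa [intervalIntegrable_iff_integrableOn_Icc_of_le (by norm_num)] at h3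

noncomputable def gnear (ξ k : ℝ) : ℝ :=
  (Set.Icc (-1 : ℝ) 1).indicator (fun k => |k| ^ (-ξ)) k + (1 / 2 * (1 + k ^ 2)) ^ (-(2 + ξ) / 2)

noncomputable def bnd (ξ L R : ℝ) (j : ℤ) (k : ℝ) : ℝ :=
  (if j = 0 then 4 * (1 + R ^ 2) else 0) * gnear ξ k +
    4 * ((j : ℝ) ^ 2 / L ^ 2) ^ (-(1 + ξ / 2) / 2) *
      (min 1 (1 / L ^ 2) * (1 + k ^ 2)) ^ (-(1 + ξ / 2) / 2)

lemma gnear_nonneg (ξ k : ℝ) : 0 ≤ gnear ξ k := by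
  unfold gnear
  have : 0 ≤ (Set.Icc (-1 : ℝ) 1).indicator (fun k => |k| ^ (-ξ)) k :=
    Set.indicator_nonneg (fun k _ => by positivity) k
  positivity

lemma integrable_gnear (ξ : ℝ) (h0 : 0 < ξ) (h : ξ < 1) : Integrable (gnear ξ) :=
  (integrable_near ξ h).add (integrable_W (1 / 2) (2 + ξ) (by norm_num) (by linarith))

lemma integrable_bnd (ξ L R : ℝ) (hL : 0 < L) (h0 : 0 < ξ) (h : ξ < 1) (j : ℤ) :
    Integrable (bnd ξ L R j) :=
  ((integrable_gnear ξ h0 h).const_mul _).add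
    ((integrable_W _ (1 + ξ / 2) (by positivity) (by linarith)).const_mul _)

lemma summable_bnd (ξ L R : ℝ) (hL : 0 < L) (h0 : 0 < ξ) (h : ξ < 1) :
    Summable (fun j : ℤ => ∫ k, bnd ξ L R j k) := by
  have hs : Summable (fun j : ℤ => ((j : ℝ) ^ 2 / L ^ 2) ^ (-(1 + ξ / 2) / 2)) := by
    have h1 := (Real.summable_abs_int_rpow (b := 1 + ξ / 2) (by linarith)).mul_right
      ((L ^ 2) ^ (-(1 + ξ / 2) / 2))⁻¹
    refine h1.congr fun j => ?_
    rw [Real.div_rpow (by positivity) (by positivity), div_eq_mul_inv]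
    congr 1
    rw [← sq_abs, ← Real.rpow_natCast, ← Real.rpow_mul (abs_nonneg _)]
    congr 1
    push_cast
    ring
  have e : (fun j : ℤ => ∫ k, bnd ξ L R j k) = fun j : ℤ =>
      (if j = 0 then 4 * (1 + R ^ 2) else 0) * (∫ k, gnear ξ k) +
      4 * ((j : ℝ) ^ 2 / L ^ 2) ^ (-(1 + ξ / 2) / 2) *
      ∫ k : ℝ, (min 1 (1 / L ^ 2) * (1 + k ^ 2)) ^ (-(1 + ξ / 2) / 2) := by
    funext j
    unfold bnd
    rw [integral_add ((integrable_gnear ξ h0 h).const_mul _)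
      ((integrable_W _ (1 + ξ / 2) (by positivity) (by linarith)).const_mul _),
      integral_const_mul, integral_const_mul]
  rw [e]
  refine Summable.add (Summable.mul_right _ ?_) (Summable.mul_right _ (hs.mul_left 4))
  apply summable_of_ne_finset_zero (s := {0})
  intro j hj
  simp at hj
  simp [hj]

lemma abs_Acyl_le (p k₁ k₂ : ℝ) (hp : p ∈ Set.Icc (0 : ℝ) 1) (α β : Fin 2) :
    |Acyl p k₁ k₂ α β| ≤ 2 := by
  obtain ⟨h0, h1⟩ := hp
  unfold Acyl
  have a1 : |(1 - p) * (if α = β then (1 : ℝ) else 0)| ≤ 1 := by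
    split_ifs
    · rw [abs_le]; constructor <;> linarith
    · simp
  have hq : |![k₁, k₂] α * ![k₁, k₂] β| ≤ k₁ ^ 2 + k₂ ^ 2 := by
    rw [abs_le]
    fin_cases α <;> fin_cases β <;> simp <;> constructor <;>
      nlinarith [sq_nonneg (k₁ + k₂), sq_nonneg (k₁ - k₂), sq_nonneg k₁, sq_nonneg k₂]
  have a2 : |(2 * p - 1) * (![k₁, k₂] α * ![k₁, k₂] β) / (k₁ ^ 2 + k₂ ^ 2)| ≤ 1 := by
    rw [abs_div, abs_mul, abs_of_nonneg (show 0 ≤ k₁ ^ 2 + k₂ ^ 2 by positivity)]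
    apply div_le_one_of_le₀ _ (by positivity)
    have : |2 * p - 1| ≤ 1 := by rw [abs_le]; constructor <;> linarith
    calc _ ≤ 1 * (k₁ ^ 2 + k₂ ^ 2) := by gcongr
      _ = _ := one_mul _
  refine (abs_add_le _ _).trans ?_
  linarith

lemma measurable_Acyl (p k₂ : ℝ) (α β : Fin 2) : Measurable (fun k => Acyl p k k₂ α β) := by
  have h : ∀ α : Fin 2, Measurable (fun k : ℝ => ![k, k₂] α) := by
    intro α
    fin_cases α
    · exact measurable_id
    · simp
  unfold Acyl
  have := h α
  have := h β
  fun_prop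

lemma abs_one_sub_cos_le (θ : ℝ) : |1 - Real.cos θ| ≤ 2 := by
  rw [abs_le]; constructor <;> linarith [Real.cos_le_one θ, Real.neg_one_le_cos θ]

lemma main_bound (ξ p L R : ℝ) (h0 : 0 < ξ) (hp : p ∈ Set.Icc (0 : ℝ) 1)
    (hL : 0 < L) (α β : Fin 2) (r : ℝ × ℝ) (hr : |r.1| ≤ R) (j : ℤ) (k : ℝ) :
    |1 - Real.cos (k * r.1 + (j : ℝ) / L * r.2)| * |Acyl p k ((j : ℝ) / L) α β| *
          (k ^ 2 + (j : ℝ) ^ 2 / L ^ 2) ^ (-(2 + ξ) / 2) ≤ bnd ξ L R j k := by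
  have hA := abs_Acyl_le p k ((j : ℝ) / L) hp α β
  have hc := abs_one_sub_cos_le (k * r.1 + (j : ℝ) / L * r.2)
  have hg := gnear_nonneg ξ k
  by_cases hj : j = 0
  · subst hj
    have key : |1 - Real.cos (k * r.1)| * (k ^ 2) ^ (-(2 + ξ) / 2) ≤ 2 * (1 + R ^ 2) * gnear ξ k := by
      by_cases hk : k ∈ Set.Icc (-1 : ℝ) 1
      · have hgl : |k| ^ (-ξ) ≤ gnear ξ k := by
          unfold gnear
          rw [Set.indicator_of_mem hk]
          have : 0 ≤ (1 / 2 * (1 + k ^ 2)) ^ (-(2 + ξ) / 2) := by positivity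
          linarith
        have hcos : |1 - Real.cos (k * r.1)| ≤ R ^ 2 * k ^ 2 := by
          rw [abs_of_nonneg (by linarith [Real.cos_le_one (k * r.1)])]
          have h1 := Real.one_sub_sq_div_two_le_cos (x := k * r.1)
          have h2 : r.1 ^ 2 ≤ R ^ 2 := sq_le_sq' (by linarith [neg_abs_le r.1]) (by linarith [le_abs_self r.1])
          nlinarith [sq_nonneg k, sq_nonneg r.1, mul_nonneg (sq_nonneg k) (sub_nonneg.2 h2), mul_nonneg (sq_nonneg k) (sq_nonneg r.1)]
        rcases eq_or_ne k 0 with rfl | hk0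
        · simp; positivity
        have e : k ^ 2 * (k ^ 2) ^ (-(2 + ξ) / 2) = |k| ^ (-ξ) := by
          have hpos : 0 < |k| := abs_pos.2 hk0
          rw [← sq_abs, ← Real.rpow_natCast, ← Real.rpow_mul hpos.le, ← Real.rpow_add hpos]
          congr 1
          push_cast
          ring
        calc _ ≤ R ^ 2 * k ^ 2 * (k ^ 2) ^ (-(2 + ξ) / 2) := by gcongr
          _ = R ^ 2 * |k| ^ (-ξ) := by rw [mul_assoc, e]
          _ ≤ R ^ 2 * gnear ξ k := by gcongr
          _ ≤ _ := by nlinarith [sq_nonneg R, mul_nonneg (sq_nonneg R) hg]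
      · have hk1 : 1 ≤ k ^ 2 := by
          by_contra hcon
          exact hk ⟨by nlinarith, by nlinarith⟩
        have hgl : (k ^ 2) ^ (-(2 + ξ) / 2) ≤ gnear ξ k := by
          unfold gnear
          rw [Set.indicator_of_notMem hk, zero_add]
          exact Real.rpow_le_rpow_of_nonpos (by positivity) (by linarith) (by linarith)
        calc _ ≤ 2 * gnear ξ k := by
              gcongr
              exact abs_one_sub_cos_le _
          _ ≤ _ := by nlinarith [mul_nonneg (sq_nonneg R) hg]
    have hz : bnd ξ L R 0 k = 4 * (1 + R ^ 2) * gnear ξ k := by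
      unfold bnd
      have : (0 : ℝ) ^ (-(1 + ξ / 2) / 2) = 0 := Real.zero_rpow (by linarith)
      simp only [if_true, Int.cast_zero, ne_eq, OfNat.ofNat_ne_zero, not_false_eq_true, zero_pow,
        zero_div, this, mul_zero, zero_mul, add_zero]
    rw [hz]
    simp only [Int.cast_zero, zero_div, zero_mul, add_zero, ne_eq, OfNat.ofNat_ne_zero,
      not_false_eq_true, zero_pow] at hA hc ⊢
    have h5 : 0 ≤ |1 - Real.cos (k * r.1)| * (k ^ 2) ^ (-(2 + ξ) / 2) := by positivity
    nlinarith [mul_le_mul_of_nonneg_left hA h5]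
  · have hj1 : (1 : ℝ) ≤ (j : ℝ) ^ 2 := by
      have := Int.one_le_abs hj
      have h2 : (1 : ℝ) ≤ |(j : ℝ)| := by exact_mod_cast this
      rw [← sq_abs]; nlinarith
    have hja : 1 / L ^ 2 ≤ (j : ℝ) ^ 2 / L ^ 2 := by gcongr
    have hL2 : 0 < 1 / L ^ 2 := by positivity
    have hb : bnd ξ L R j k = 4 * (((j : ℝ) ^ 2 / L ^ 2) ^ (-(1 + ξ / 2) / 2) *
      (min 1 (1 / L ^ 2) * (1 + k ^ 2)) ^ (-(1 + ξ / 2) / 2)) := by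
      simp [bnd, hj]; ring
    have hpos : 0 < k ^ 2 + (j : ℝ) ^ 2 / L ^ 2 := by nlinarith [sq_nonneg k]
    rw [hb, show -(2 + ξ) / 2 = -(1 + ξ / 2) / 2 + -(1 + ξ / 2) / 2 by ring, Real.rpow_add hpos]
    have b1 : (k ^ 2 + (j : ℝ) ^ 2 / L ^ 2) ^ (-(1 + ξ / 2) / 2) ≤
        ((j : ℝ) ^ 2 / L ^ 2) ^ (-(1 + ξ / 2) / 2) :=
      Real.rpow_le_rpow_of_nonpos (by linarith) (by nlinarith [sq_nonneg k]) (by linarith)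
    have b2 : (k ^ 2 + (j : ℝ) ^ 2 / L ^ 2) ^ (-(1 + ξ / 2) / 2) ≤
        (min 1 (1 / L ^ 2) * (1 + k ^ 2)) ^ (-(1 + ξ / 2) / 2) := by
      refine Real.rpow_le_rpow_of_nonpos (by positivity) ?_ (by linarith)
      nlinarith [min_le_left 1 (1 / L ^ 2), min_le_right 1 (1 / L ^ 2),
        mul_le_mul_of_nonneg_right (min_le_left 1 (1 / L ^ 2)) (sq_nonneg k)]
    have b3 : |1 - Real.cos (k * r.1 + (j : ℝ) / L * r.2)| * |Acyl p k ((j : ℝ) / L) α β| ≤ 4 := by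
      calc _ ≤ 2 * (2 : ℝ) := by gcongr
        _ = 4 := by norm_num
    gcongr

lemma meas_F (ξ p L : ℝ) (α β : Fin 2) (r : ℝ × ℝ) (j : ℤ) :
    Measurable (fun k : ℝ => (1 - Real.cos (k * r.1 + (j : ℝ) / L * r.2)) *
      Acyl p k ((j : ℝ) / L) α β * (k ^ 2 + (j : ℝ) ^ 2 / L ^ 2) ^ (-(2 + ξ) / 2)) := by
  have := measurable_Acyl p ((j : ℝ) / L) α β
  fun_prop

lemma norm_F (ξ p L : ℝ) (α β : Fin 2) (r : ℝ × ℝ) (j : ℤ) (k : ℝ) :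
    ‖(1 - Real.cos (k * r.1 + (j : ℝ) / L * r.2)) *
      Acyl p k ((j : ℝ) / L) α β * (k ^ 2 + (j : ℝ) ^ 2 / L ^ 2) ^ (-(2 + ξ) / 2)‖ =
    |1 - Real.cos (k * r.1 + (j : ℝ) / L * r.2)| * |Acyl p k ((j : ℝ) / L) α β| *
          (k ^ 2 + (j : ℝ) ^ 2 / L ^ 2) ^ (-(2 + ξ) / 2) := by
  rw [norm_mul, norm_mul, Real.norm_eq_abs, Real.norm_eq_abs, Real.norm_of_nonneg (by positivity)]

/-- For `ξ ∈ (0,1)`, `℘ ∈ [0,1]`, `L > 0`: each integral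
`∫_ℝ |1 − cos(k₁r₁ + (j/L)r₂)| |A_{αβ}((k₁, j/L);℘)| (k₁² + j²/L²)^{−(2+ξ)/2} dk₁` converges
absolutely, their sum over `j ∈ ℤ` is finite, and hence the function `d_{αβ}` is well defined
and continuous on `ℝ²`. -/
theorem stmt_9 (ξ p L : ℝ) (hξ : ξ ∈ Set.Ioo (0 : ℝ) 1) (hp : p ∈ Set.Icc (0 : ℝ) 1)
    (hL : 0 < L) :
    (∀ (α β : Fin 2) (r : ℝ × ℝ) (j : ℤ),
      Integrable (fun k₁ : ℝ =>
        |1 - Real.cos (k₁ * r.1 + (j : ℝ) / L * r.2)| * |Acyl p k₁ ((j : ℝ) / L) α β| *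
          (k₁ ^ 2 + (j : ℝ) ^ 2 / L ^ 2) ^ (-(2 + ξ) / 2))) ∧
    (∀ (α β : Fin 2) (r : ℝ × ℝ),
      Summable (fun j : ℤ => ∫ k₁ : ℝ,
        |1 - Real.cos (k₁ * r.1 + (j : ℝ) / L * r.2)| * |Acyl p k₁ ((j : ℝ) / L) α β| *
          (k₁ ^ 2 + (j : ℝ) ^ 2 / L ^ 2) ^ (-(2 + ξ) / 2))) ∧
    (∀ α β : Fin 2, Continuous (dcov p ξ L α β)) := by
  obtain ⟨h0, h1⟩ := hξ
  have hint : ∀ (α β : Fin 2) (r : ℝ × ℝ) (j : ℤ),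
      Integrable (fun k₁ : ℝ =>
        |1 - Real.cos (k₁ * r.1 + (j : ℝ) / L * r.2)| * |Acyl p k₁ ((j : ℝ) / L) α β| *
          (k₁ ^ 2 + (j : ℝ) ^ 2 / L ^ 2) ^ (-(2 + ξ) / 2)) := by
    intro α β r j
    have hi : Integrable (fun k : ℝ => (1 - Real.cos (k * r.1 + (j : ℝ) / L * r.2)) *
      Acyl p k ((j : ℝ) / L) α β * (k ^ 2 + (j : ℝ) ^ 2 / L ^ 2) ^ (-(2 + ξ) / 2)) := by
      refine (integrable_bnd ξ L |r.1| hL h0 h1 j).mono'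
        (meas_F ξ p L α β r j).aestronglyMeasurable (Filter.Eventually.of_forall fun k => ?_)
      rw [norm_F]
      exact main_bound ξ p L _ h0 hp hL α β r le_rfl j k
    exact hi.norm.congr (Filter.Eventually.of_forall fun k => norm_F ξ p L α β r j k)
  refine ⟨hint, ?_, ?_⟩
  · intro α β r
    refine Summable.of_nonneg_of_le (fun j => integral_nonneg fun k => by positivity) (fun j => ?_)
      (summable_bnd ξ L |r.1| hL h0 h1)
    exact integral_mono (hint α β r j) (integrable_bnd ξ L |r.1| hL h0 h1 j)
      fun k => main_bound ξ p L _ h0 hp hL α β r le_rfl j k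
  · intro α β
    rw [continuous_iff_continuousAt]
    intro r₀
    set R := |r₀.1| + 1 with hR
    have hopen : IsOpen {r : ℝ × ℝ | |r.1| < R} :=
      isOpen_lt (by fun_prop) continuous_const
    refine ContinuousOn.continuousAt (s := {r : ℝ × ℝ | |r.1| < R}) ?_
      (hopen.mem_nhds (by simp [hR]))
    unfold dcov
    refine continuousOn_const.mul (continuousOn_tsum (u := fun j => ∫ k, bnd ξ L R j k) ?_
      (summable_bnd ξ L R hL h0 h1) ?_)
    · intro j
      refine MeasureTheory.continuousOn_of_dominated (bound := bnd ξ L R j)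
        (fun r _ => (meas_F ξ p L α β r j).aestronglyMeasurable) ?_
        (integrable_bnd ξ L R hL h0 h1 j) ?_
      · intro r hr
        refine Filter.Eventually.of_forall fun k => ?_
        rw [norm_F]
        exact main_bound ξ p L _ h0 hp hL α β r (le_of_lt hr) j k
      · refine Filter.Eventually.of_forall fun k => ?_
        fun_prop
    · intro j r hr
      refine norm_integral_le_of_norm_le (integrable_bnd ξ L R hL h0 h1 j)
        (Filter.Eventually.of_forall fun k => ?_)
      rw [norm_F]
      exact main_bound ξ p L _ h0 hp hL α β r (le_of_lt hr) j k
end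

section
/- Fix ξ ∈ (0,1), ℘ ∈ (0,1], and L > 0. Set 𝔇₁ = ℘ |Γ(−(1+ξ)/2)| / (2^{3+ξ} π^{3/2} Γ(1+ξ/2) L) and ϰ₁ = [1+(1−℘)ξ] L^{ξ} Γ((1+ξ)/2) ζ(1+ξ) / (2 π^{3/2} (2+ξ) Γ(1+ξ/2)), where ζ is the Riemann zeta function. Then d₁₁(r) − 𝔇₁ |r₁|^{1+ξ} → ϰ₁ as |r₁| → ∞, uniformly in r₂ ∈ [−πL, πL). -/
open MeasureTheory Real

lemma tonelli_swap {μ ν : Measure ℝ} [SFinite μ] [SFinite ν] (f : ℝ → ℝ → ℝ)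
    (hf : Measurable (Function.uncurry f))
    (h1 : ∀ᵐ x ∂μ, (∀ᵐ y ∂ν, 0 ≤ f x y) ∧ Integrable (f x) ν)
    (h2 : ∀ᵐ y ∂ν, (∀ᵐ x ∂μ, 0 ≤ f x y) ∧ Integrable (fun x => f x y) μ) :
    ∫ x, ∫ y, f x y ∂ν ∂μ = ∫ y, ∫ x, f x y ∂μ ∂ν := by
  have hm1 : StronglyMeasurable fun x => ∫ y, f x y ∂ν :=
    StronglyMeasurable.integral_prod_right hf.stronglyMeasurable
  have hm2 : StronglyMeasurable fun y => ∫ x, f x y ∂μ :=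
    StronglyMeasurable.integral_prod_right (f := fun y x => f x y)
      (hf.comp measurable_swap).stronglyMeasurable
  rw [integral_eq_lintegral_of_nonneg_ae (by
      filter_upwards [h1] with x hx using integral_nonneg_of_ae hx.1) hm1.aestronglyMeasurable,
    integral_eq_lintegral_of_nonneg_ae (by
      filter_upwards [h2] with x hx using integral_nonneg_of_ae hx.1) hm2.aestronglyMeasurable]
  congr 1
  have e1 : ∫⁻ x, ENNReal.ofReal (∫ y, f x y ∂ν) ∂μ = ∫⁻ x, ∫⁻ y, ENNReal.ofReal (f x y) ∂ν ∂μ := by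
    apply lintegral_congr_ae
    filter_upwards [h1] with x hx
    exact ofReal_integral_eq_lintegral_ofReal hx.2 hx.1
  have e2 : ∫⁻ y, ENNReal.ofReal (∫ x, f x y ∂μ) ∂ν = ∫⁻ y, ∫⁻ x, ENNReal.ofReal (f x y) ∂μ ∂ν := by
    apply lintegral_congr_ae
    filter_upwards [h2] with x hx
    exact ofReal_integral_eq_lintegral_ofReal hx.2 hx.1
  rw [e1, e2]
  exact lintegral_lintegral_swap (ENNReal.measurable_ofReal.comp hf).aemeasurable

lemma gamma_int {a r : ℝ} (ha : 0 < a) (hr : 0 < r) :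
    IntegrableOn (fun t : ℝ => t ^ (a - 1) * exp (-(r * t))) (Set.Ioi 0) := by
  have := integrableOn_rpow_mul_exp_neg_mul_rpow (p := 1) (s := a - 1) (b := r)
    (by linarith) one_pos hr
  simpa using this

lemma B_formula {s : ℝ} (hs : 1 / 2 < s) :
    ∫ x : ℝ, (1 + x ^ 2) ^ (-s) = √π * Gamma (s - 1 / 2) / Gamma s := by
  have hG : 0 < Gamma s := Gamma_pos_of_pos (by linarith)
  rw [eq_div_iff hG.ne', ← integral_mul_const]
  have key := tonelli_swap (μ := volume) (ν := volume.restrict (Set.Ioi 0))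
    (fun x t => t ^ (s - 1) * exp (-((1 + x ^ 2) * t))) (by fun_prop)
    (by
      refine Filter.Eventually.of_forall fun x => ⟨?_, gamma_int (by linarith) (by positivity)⟩
      filter_upwards [ae_restrict_mem measurableSet_Ioi] with t ht
      have : 0 < t := ht
      positivity)
    (by
      filter_upwards [ae_restrict_mem measurableSet_Ioi] with t ht
      have : 0 < t := ht
      refine ⟨Filter.Eventually.of_forall fun x => by positivity, ?_⟩
      refine (((integrable_exp_neg_mul_sq this).const_mul (t ^ (s - 1) * exp (-t)))).congr
        (Filter.Eventually.of_forall fun x => ?_)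
      simp only [mul_assoc, ← exp_add]
      congr 2; ring)
  convert key using 1
  · congr 1; ext x
    rw [integral_rpow_mul_exp_neg_mul_Ioi (by linarith) (by positivity), rpow_neg (by positivity),
      one_div, inv_rpow (by positivity)]
  · have : ∀ t ∈ Set.Ioi (0:ℝ), ∫ x : ℝ, t ^ (s - 1) * exp (-((1 + x ^ 2) * t))
        = √π * (t ^ (s - 1 / 2 - 1) * exp (-(1 * t))) := by
      intro t ht
      have ht : 0 < t := ht
      have : ∀ x : ℝ, t ^ (s - 1) * exp (-((1 + x ^ 2) * t))
        = (t ^ (s - 1) * exp (-t)) * exp (-t * x ^ 2) := by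
        intro x; simp only [mul_assoc, ← exp_add]; congr 2; ring
      simp_rw [this]
      rw [integral_const_mul, integral_gaussian, sqrt_div pi_nonneg,
        show s - 1 / 2 - 1 = (s - 1) - 1 / 2 by ring, rpow_sub ht (s-1), ← sqrt_eq_rpow, one_mul]
      ring
    rw [setIntegral_congr_fun measurableSet_Ioi this, integral_const_mul,
      integral_rpow_mul_exp_neg_mul_Ioi (by linarith) one_pos]
    simp

lemma gauss_cos {t : ℝ} (ht : 0 < t) :
    Integrable (fun x : ℝ => cos x * exp (-t * x ^ 2)) ∧
    ∫ x : ℝ, cos x * exp (-t * x ^ 2) = √(π / t) * exp (-(1 / (4 * t))) := by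
  have hi : Integrable (fun x : ℝ => cos x * exp (-t * x ^ 2)) := by
    refine (integrable_exp_neg_mul_sq ht).bdd_mul (c := 1) (by fun_prop) ?_
    exact Filter.Eventually.of_forall fun x => by simpa using abs_cos_le_one x
  have hi2 : Integrable (fun x : ℝ => sin x * exp (-t * x ^ 2)) := by
    refine (integrable_exp_neg_mul_sq ht).bdd_mul (c := 1) (by fun_prop) ?_
    exact Filter.Eventually.of_forall fun x => by simpa using abs_sin_le_one x
  refine ⟨hi, ?_⟩
  have h := fourierIntegral_gaussian (b := (t : ℂ)) (by simpa using ht) 1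
  have e : ∀ x : ℝ, Complex.exp (Complex.I * 1 * x) * Complex.exp (-t * x ^ 2) =
      ((cos x * exp (-t * x ^ 2) : ℝ) : ℂ) + ((sin x * exp (-t * x ^ 2) : ℝ) : ℂ) * Complex.I := by
    intro x
    rw [mul_one, mul_comm Complex.I, Complex.exp_mul_I]
    push_cast
    ring
  simp_rw [e] at h
  rw [integral_add hi.ofReal (hi2.ofReal.mul_const _), integral_mul_const] at h
  have h3 := congrArg Complex.re h
  rw [integral_complex_ofReal, integral_complex_ofReal] at h3
  have e3 : ((π:ℂ) / (t:ℂ)) ^ (1 / 2 : ℂ) * Complex.exp (-1 ^ 2 / (4 * t)) =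
    ((√(π / t) * exp (-(1 / (4 * t))) : ℝ) : ℂ) := by
    rw [sqrt_eq_rpow]
    push_cast [Complex.ofReal_cpow (by positivity : 0 ≤ π / t)]
    congr 2
    ring
  rw [e3, Complex.ofReal_re] at h3
  simpa using h3

lemma one_sub_exp_int {σ : ℝ} (h0 : 0 < σ) (h1 : σ < 1) :
    ∫ u in Set.Ioi (0:ℝ), u ^ (-σ - 1) * (1 - exp (-(u / 4))) =
      Gamma (1 - σ) * ((1 / 4) ^ σ / σ) := by
  have key := tonelli_swap (μ := volume.restrict (Set.Ioi 0)) (ν := volume.restrict (Set.Ioc 0 (1/4)))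
    (fun u v => u ^ ((1 - σ) - 1) * exp (-(v * u))) (by fun_prop)
    (by
      filter_upwards [ae_restrict_mem measurableSet_Ioi] with u hu
      have : 0 < u := hu
      refine ⟨Filter.Eventually.of_forall fun x => by positivity, ?_⟩
      refine ContinuousOn.integrableOn_Icc (a := 0) (b := 1/4) (by fun_prop) |>.mono_set Set.Ioc_subset_Icc_self)
    (by
      filter_upwards [ae_restrict_mem measurableSet_Ioc] with v hv
      refine ⟨?_, gamma_int (by linarith) hv.1⟩
      filter_upwards [ae_restrict_mem measurableSet_Ioi] with u hu
      have : 0 < u := hu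
      positivity)
  convert key using 1
  · apply setIntegral_congr_fun measurableSet_Ioi
    intro u hu
    have hu : 0 < u := hu
    dsimp only
    rw [integral_const_mul, ← intervalIntegral.integral_of_le (by norm_num)]
    have : ∫ v in (0:ℝ)..(1/4), exp (-(v * u)) = (1 - exp (-(u / 4))) / u := by
      have : ∀ v ∈ Set.uIcc (0:ℝ) (1/4), HasDerivAt (fun v => - exp (-(v * u)) / u) (exp (-(v * u))) v := by
        intro v _
        have := (((hasDerivAt_id v).mul_const u).neg.exp.neg).div_const u
        refine HasDerivAt.congr_deriv this ?_
        simp; field_simp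
      rw [intervalIntegral.integral_eq_sub_of_hasDerivAt this (Continuous.intervalIntegrable (by fun_prop) _ _)]
      simp; field_simp; ring_nf
    rw [this, show (1 - σ) - 1 = (-σ - 1) + 1 by ring, rpow_add_one hu.ne']
    field_simp
  · have : ∀ v ∈ Set.Ioc (0:ℝ) (1/4), ∫ u in Set.Ioi 0, u ^ ((1 - σ) - 1) * exp (-(v * u)) =
      Gamma (1 - σ) * v ^ (σ - 1) := by
      intro v hv
      rw [integral_rpow_mul_exp_neg_mul_Ioi (by linarith) hv.1, one_div, inv_rpow hv.1.le,
        ← rpow_neg hv.1.le, mul_comm]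
      congr 2; ring
    rw [setIntegral_congr_fun measurableSet_Ioc this, integral_const_mul,
      ← intervalIntegral.integral_of_le (by norm_num), integral_rpow (Or.inl (by linarith))]
    simp [zero_rpow h0.ne']

lemma C_formula {σ : ℝ} (h0 : 0 < σ) (h1 : σ < 1) :
    ∫ x : ℝ, (1 - cos x) * (x ^ 2) ^ (-(σ + 1 / 2)) =
      √π * (1 / 4) ^ σ * |Gamma (-σ)| / Gamma (σ + 1 / 2) := by
  have hG : 0 < Gamma (σ + 1 / 2) := Gamma_pos_of_pos (by linarith)
  have hab : |Gamma (-σ)| = Gamma (1 - σ) / σ := by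
    have := Gamma_add_one (s := -σ) (by linarith)
    have h3 : 0 < Gamma (1 - σ) := Gamma_pos_of_pos (by linarith)
    rw [show -σ + 1 = 1 - σ by ring] at this
    rw [abs_of_neg (by by_contra h; push Not at h; nlinarith), eq_div_iff h0.ne', this]; ring
  rw [eq_div_iff hG.ne', ← integral_mul_const, hab]
  have key := tonelli_swap (μ := volume) (ν := volume.restrict (Set.Ioi 0))
    (fun x t => (1 - cos x) * (t ^ ((σ + 1 / 2) - 1) * exp (-(x ^ 2 * t)))) (by fun_prop)
    (by
      have h : ∀ᵐ x : ℝ, x ≠ 0 := by simp [ae_iff]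
      filter_upwards [h] with x hx
      refine ⟨?_, (gamma_int (by linarith) (by positivity)).const_mul _⟩
      filter_upwards [ae_restrict_mem measurableSet_Ioi] with t ht
      have : 0 < t := ht
      have := cos_le_one x
      have : 0 ≤ 1 - cos x := by linarith
      positivity)
    (by
      filter_upwards [ae_restrict_mem measurableSet_Ioi] with t ht
      have : 0 < t := ht
      refine ⟨Filter.Eventually.of_forall fun x => by
        have := cos_le_one x
        have : 0 ≤ 1 - cos x := by linarith
        positivity, ?_⟩
      refine (((integrable_exp_neg_mul_sq this).sub (gauss_cos this).1).const_mul
        (t ^ ((σ + 1 / 2) - 1))).congr (Filter.Eventually.of_forall fun x => ?_)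
      simp only [Pi.sub_apply]
      rw [show -t * x ^ 2 = -(x ^ 2 * t) by ring]; ring)
  convert key using 1
  · apply integral_congr_ae
    have h : ∀ᵐ x : ℝ, x ≠ 0 := by simp [ae_iff]
    filter_upwards [h] with x hx
    rw [integral_const_mul, integral_rpow_mul_exp_neg_mul_Ioi (by linarith) (by positivity),
      rpow_neg (by positivity), one_div (x^2), inv_rpow (by positivity), mul_assoc]
  · have : ∀ t ∈ Set.Ioi (0:ℝ),
        ∫ x : ℝ, (1 - cos x) * (t ^ ((σ + 1 / 2) - 1) * exp (-(x ^ 2 * t)))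
        = √π * ((|(-1:ℝ)| * t ^ ((-1:ℝ) - 1)) • ((t ^ (-1:ℝ)) ^ (-σ - 1) * (1 - exp (-(t ^ (-1:ℝ) / 4))))) := by
      intro t ht
      have ht : 0 < t := ht
      have : ∀ x : ℝ, (1 - cos x) * (t ^ ((σ + 1 / 2) - 1) * exp (-(x ^ 2 * t)))
        = t ^ ((σ + 1 / 2) - 1) * (exp (-t * x ^ 2) - cos x * exp (-t * x ^ 2)) := by
        intro x; rw [show -t * x ^ 2 = -(x ^ 2 * t) by ring]; ring
      simp_rw [this]
      rw [integral_const_mul, integral_sub (integrable_exp_neg_mul_sq ht) (gauss_cos ht).1,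
        (gauss_cos ht).2, integral_gaussian, sqrt_div pi_nonneg, smul_eq_mul, ← rpow_mul ht.le]
      have e1 : t ^ ((σ + 1 / 2) - 1) = t ^ (σ - 1) * √t := by
        rw [sqrt_eq_rpow, ← rpow_add ht]; congr 1; ring
      have e2 : t ^ ((-1:ℝ) - 1) * t ^ (-1 * (-σ - 1)) = t ^ (σ - 1) := by
        rw [← rpow_add ht]; congr 1; ring
      have e3 : 1 / (4 * t) = t ^ (-1 : ℝ) / 4 := by
        rw [rpow_neg_one]; field_simp
      have : √t ≠ 0 := by positivity
      rw [e1, e3]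
      simp only [abs_neg, abs_one, one_mul]
      rw [← mul_assoc (t ^ ((-1:ℝ) - 1)), e2]
      field_simp
    rw [setIntegral_congr_fun measurableSet_Ioi this, integral_const_mul,
      integral_comp_rpow_Ioi (fun u => u ^ (-σ - 1) * (1 - exp (-(u / 4)))) (by norm_num),
      one_sub_exp_int h0 h1]
    ring

lemma RL_cos (g : ℝ → ℝ) (hg : Integrable g) (δ : ℝ) (hδ : 0 < δ) :
    ∃ T : ℝ, ∀ t θ : ℝ, T ≤ |t| → |∫ x : ℝ, cos (x * t + θ) * g x| ≤ δ := by
  have h := Real.tendsto_integral_exp_smul_cocompact (fun x => (g x : ℂ))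
  have h2 := (NormedAddGroup.tendsto_nhds_zero.mp h) δ hδ
  rw [← Metric.cobounded_eq_cocompact, (Metric.hasBasis_cobounded_compl_closedBall (0:ℝ)).eventually_iff] at h2
  obtain ⟨R, -, hR⟩ := h2
  refine ⟨2 * π * (|R| + 1), fun t θ ht => ?_⟩
  have hw : (-(t / (2 * π))) ∈ (Metric.closedBall (0:ℝ) R)ᶜ := by
    simp only [Set.mem_compl_iff, Metric.mem_closedBall, dist_zero_right, norm_neg, norm_div,
      Real.norm_eq_abs, not_le]
    rw [abs_of_pos (by positivity : (0:ℝ) < 2 * π), lt_div_iff₀ (by positivity)]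
    have := le_abs_self R
    nlinarith [pi_pos]
  have h3 := hR hw
  refine le_trans ?_ h3.le
  have e : ∀ x : ℝ, ((cos (x * t + θ) * g x : ℝ)) =
      (Complex.exp (θ * Complex.I) * (Real.fourierChar (-(x * (-(t / (2 * π))))) • (g x : ℂ))).re := by
    intro x
    rw [Circle.smul_def, Real.fourierChar_apply, smul_eq_mul, ← mul_assoc, ← Complex.exp_add,
      Complex.re_mul_ofReal]
    congr 1
    have : (θ * Complex.I + ((2 * π * -(x * -(t / (2 * π))) : ℝ) : ℂ) * Complex.I) =
      ((x * t + θ : ℝ) : ℂ) * Complex.I := by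
      have : 2 * π * -(x * -(t / (2 * π))) = x * t := by field_simp
      rw [this]; push_cast; ring
    rw [this, Complex.exp_ofReal_mul_I_re]
  have hint : Integrable (fun x : ℝ => Complex.exp (θ * Complex.I) *
      (Real.fourierChar (-(x * (-(t / (2 * π))))) • (g x : ℂ))) := by
    apply Integrable.const_mul
    have : Integrable (fun x => (g x : ℂ)) := hg.ofReal
    simp_rw [Circle.smul_def, smul_eq_mul]
    refine this.bdd_mul (c := 1) ?_ (Filter.Eventually.of_forall fun x => (Circle.norm_coe _).le)
    exact Continuous.aestronglyMeasurable (by fun_prop)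
  simp_rw [e]
  have h4 : ∫ x : ℝ, (Complex.exp (θ * Complex.I) *
      (Real.fourierChar (-(x * (-(t / (2 * π))))) • (g x : ℂ))).re = _ := integral_re hint
  rw [h4, integral_const_mul]
  refine (Complex.abs_re_le_norm _).trans ?_
  rw [norm_mul, Complex.norm_exp_ofReal_mul_I, one_mul]

noncomputable def Gfun (p ξ x : ℝ) : ℝ :=
  p * (1 + x ^ 2) ^ (-(1 + ξ / 2)) - (2 * p - 1) * (1 + x ^ 2) ^ (-(2 + ξ / 2))

noncomputable def Kc (p ξ : ℝ) : ℝ :=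
  √π * Gamma ((1 + ξ) / 2) / Gamma (1 + ξ / 2) * ((1 + (1 - p) * ξ) / (2 + ξ))

lemma int_pow {s : ℝ} (hs : 1 / 2 < s) : Integrable (fun x : ℝ => (1 + x ^ 2) ^ (-s)) := by
  have := integrable_rpow_neg_one_add_norm_sq (E := ℝ) (μ := volume) (r := 2 * s)
    (by simp; linarith)
  refine this.congr (Filter.Eventually.of_forall fun x => ?_)
  simp only [Real.norm_eq_abs, sq_abs]
  congr 1; ring

lemma Gfun_int {p ξ : ℝ} (hξ : 0 < ξ) : Integrable (Gfun p ξ) :=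
  ((int_pow (by linarith)).const_mul _).sub ((int_pow (by linarith)).const_mul _)

lemma Gfun_integral {p ξ : ℝ} (hξ : 0 < ξ) : ∫ x, Gfun p ξ x = Kc p ξ := by
  unfold Gfun Kc
  rw [integral_sub ((int_pow (by linarith)).const_mul _) ((int_pow (by linarith)).const_mul _),
    integral_const_mul, integral_const_mul, B_formula (by linarith), B_formula (by linarith)]
  have e1 : Gamma (2 + ξ / 2) = (1 + ξ / 2) * Gamma (1 + ξ / 2) := by
    rw [← Gamma_add_one (by linarith)]; congr 1; ring
  have e2 : Gamma (2 + ξ / 2 - 1 / 2) = ((1 + ξ) / 2) * Gamma ((1 + ξ) / 2) := by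
    rw [← Gamma_add_one (by linarith)]; congr 1; ring
  have e3 : Gamma (1 + ξ / 2 - 1 / 2) = Gamma ((1 + ξ) / 2) := by congr 1; ring
  have h1 : Gamma (1 + ξ / 2) ≠ 0 := (Gamma_pos_of_pos (by linarith)).ne'
  have h2 : 2 + ξ ≠ 0 := by linarith
  have h3 : 1 + ξ / 2 ≠ 0 := by linarith
  rw [e1, e2, e3]
  field_simp
  ring

lemma Tj (p ξ r₁ r₂ : ℝ) (hξ : 0 < ξ) (a : ℝ) (ha : a ≠ 0) :
    ∫ k₁ : ℝ, (1 - cos (k₁ * r₁ + a * r₂)) * Acyl p k₁ a 0 0 *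
      (k₁ ^ 2 + a ^ 2) ^ (-(2 + ξ) / 2) =
    |a| ^ (-(1 + ξ)) * (Kc p ξ - ∫ x, cos (x * (a * r₁) + a * r₂) * Gfun p ξ x) := by
  have h := Measure.integral_comp_mul_left (fun k₁ : ℝ =>
    (1 - cos (k₁ * r₁ + a * r₂)) * Acyl p k₁ a 0 0 * (k₁ ^ 2 + a ^ 2) ^ (-(2 + ξ) / 2)) a
  have ha' : 0 < |a| := abs_pos.mpr ha
  have e : ∀ x : ℝ, (1 - cos (a * x * r₁ + a * r₂)) * Acyl p (a * x) a 0 0 *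
      ((a * x) ^ 2 + a ^ 2) ^ (-(2 + ξ) / 2) =
      |a| ^ (-(2 + ξ)) * (Gfun p ξ x - cos (x * (a * r₁) + a * r₂) * Gfun p ξ x) := by
    intro x
    have hx : 0 < 1 + x ^ 2 := by positivity
    have e1 : ((a * x) ^ 2 + a ^ 2) ^ (-(2 + ξ) / 2) =
        |a| ^ (-(2 + ξ)) * (1 + x ^ 2) ^ (-(1 + ξ / 2)) := by
      rw [show (a * x) ^ 2 + a ^ 2 = |a| ^ 2 * (1 + x ^ 2) by rw [sq_abs]; ring,
        mul_rpow (by positivity) hx.le, ← rpow_natCast |a|, ← rpow_mul ha'.le]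
      congr 2
      · push_cast; ring
      · ring
    have e2 : (1 + x ^ 2) ^ (-(2 + ξ / 2)) = (1 + x ^ 2) ^ (-(1 + ξ / 2)) / (1 + x ^ 2) := by
      rw [← rpow_sub_one hx.ne']; congr 1; ring
    have e3 : Acyl p (a * x) a 0 0 = p - (2 * p - 1) / (1 + x ^ 2) := by
      unfold Acyl
      simp only [if_true, Matrix.cons_val_zero]
      rw [show (a * x) ^ 2 + a ^ 2 = a ^ 2 * (1 + x ^ 2) by ring]
      field_simp
      ring
    rw [e1, e3]
    unfold Gfun
    rw [e2, show a * x * r₁ = x * (a * r₁) by ring]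
    field_simp
  simp_rw [e] at h
  have hi : Integrable (fun x => cos (x * (a * r₁) + a * r₂) * Gfun p ξ x) := by
    refine (Gfun_int hξ).bdd_mul (c := 1) (by fun_prop) ?_
    exact Filter.Eventually.of_forall fun x => by simpa using abs_cos_le_one _
  rw [integral_const_mul, integral_sub (Gfun_int hξ) hi, Gfun_integral hξ, abs_inv, smul_eq_mul,
    eq_inv_mul_iff_mul_eq₀ ha'.ne'] at h
  rw [← h, ← mul_assoc]
  congr 1
  rw [show -(1 + ξ) = -(2 + ξ) + 1 by ring, rpow_add_one ha'.ne', mul_comm]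

lemma T0 (p ξ r₁ : ℝ) (hξ : 0 < ξ) (hξ1 : ξ < 1) (hr : r₁ ≠ 0) :
    ∫ k₁ : ℝ, (1 - cos (k₁ * r₁)) * Acyl p k₁ 0 0 0 * (k₁ ^ 2) ^ (-(2 + ξ) / 2) =
    p * |r₁| ^ (1 + ξ) * (√π * (1 / 4) ^ ((1 + ξ) / 2) * |Gamma (-(1 + ξ) / 2)|
      / Gamma (1 + ξ / 2)) := by
  have hr' : 0 < |r₁| := abs_pos.mpr hr
  have h := Measure.integral_comp_mul_left (fun k₁ : ℝ =>
    (1 - cos (k₁ * r₁)) * Acyl p k₁ 0 0 0 * (k₁ ^ 2) ^ (-(2 + ξ) / 2)) r₁⁻¹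
  have hC := C_formula (σ := (1 + ξ) / 2) (by linarith) (by linarith)
  have e : ∀ᵐ x : ℝ, (1 - cos (r₁⁻¹ * x * r₁)) * Acyl p (r₁⁻¹ * x) 0 0 0 *
      ((r₁⁻¹ * x) ^ 2) ^ (-(2 + ξ) / 2) =
      (p * |r₁| ^ (2 + ξ)) * ((1 - cos x) * (x ^ 2) ^ (-((1 + ξ) / 2 + 1 / 2))) := by
    have h : ∀ᵐ x : ℝ, x ≠ 0 := by simp [ae_iff]
    filter_upwards [h] with x hx
    have e1 : ((r₁⁻¹ * x) ^ 2) ^ (-(2 + ξ) / 2) =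
        |r₁| ^ (2 + ξ) * (x ^ 2) ^ (-((1 + ξ) / 2 + 1 / 2)) := by
      rw [mul_pow, mul_rpow (by positivity) (by positivity), ← sq_abs r₁⁻¹, abs_inv,
        ← rpow_natCast |r₁|⁻¹, ← rpow_mul (by positivity), inv_rpow hr'.le, ← rpow_neg hr'.le]
      congr 2
      · push_cast; ring
      · ring
    have e3 : Acyl p (r₁⁻¹ * x) 0 0 0 = p := by
      unfold Acyl
      simp only [if_true, Matrix.cons_val_zero]
      field_simp
      ring
    rw [e1, e3, show r₁⁻¹ * x * r₁ = x by field_simp]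
    ring
  rw [integral_congr_ae e, integral_const_mul, hC, inv_inv, smul_eq_mul] at h
  rw [show -(1 + ξ) / 2 = -((1 + ξ) / 2) by ring]
  rw [show (1 + ξ) / 2 + 1 / 2 = 1 + ξ / 2 by ring,
    show 2 + ξ = (1 + ξ) + 1 by ring, rpow_add_one hr'.ne'] at h
  have := hr'.ne'
  apply mul_left_cancel₀ this
  rw [show -(2 + ξ) / 2 = -((1 + ξ) + 1) / 2 by ring, ← h]
  ring

lemma Zsum {s : ℝ} (hs : 1 < s) :
    ∑' j : ℤ, |(j : ℝ)| ^ (-s) = 2 * ∑' n : ℕ, ((n : ℝ) + 1) ^ (-s) := by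
  rw [tsum_int_eq_zero_add_two_mul_tsum_pnat (by intro n; simp) (summable_abs_int_rpow hs),
    tsum_pnat_eq_tsum_succ (f := fun n : ℕ => |((n : ℤ) : ℝ)| ^ (-s))]
  have h : (-s) ≠ 0 := by linarith
  simp only [Int.cast_zero, abs_zero, zero_rpow h, zero_add, nsmul_eq_mul, Nat.cast_ofNat]
  congr 1
  refine tsum_congr fun n => ?_
  push_cast
  rw [abs_of_pos (by positivity)]

/-- For `ξ ∈ (0,1)`, `℘ ∈ (0,1]`, `L > 0`, with
`𝔇₁ = ℘ |Γ(−(1+ξ)/2)| / (2^{3+ξ} π^{3/2} Γ(1+ξ/2) L)` and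
`ϰ₁ = [1+(1−℘)ξ] L^ξ Γ((1+ξ)/2) ζ(1+ξ) / (2 π^{3/2} (2+ξ) Γ(1+ξ/2))` (where
`ζ(1+ξ) = ∑_{n≥1} n^{−(1+ξ)}`), one has `d₁₁(r) − 𝔇₁|r₁|^{1+ξ} → ϰ₁` as `|r₁| → ∞`, uniformly
in `r₂ ∈ [−πL, πL)`. -/
theorem stmt_10 (ξ p L : ℝ) (hξ : ξ ∈ Set.Ioo (0 : ℝ) 1) (hp : p ∈ Set.Ioc (0 : ℝ) 1)
    (hL : 0 < L) :
    ∀ ε : ℝ, 0 < ε → ∃ M : ℝ, ∀ r₁ r₂ : ℝ, M ≤ |r₁| → r₂ ∈ Set.Ico (-(π * L)) (π * L) →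
      |dcov p ξ L 0 0 (r₁, r₂) -
          p * |Real.Gamma (-(1 + ξ) / 2)| /
            ((2 : ℝ) ^ (3 + ξ) * π ^ ((3 : ℝ) / 2) * Real.Gamma (1 + ξ / 2) * L) *
            |r₁| ^ (1 + ξ) -
        (1 + (1 - p) * ξ) * L ^ ξ * Real.Gamma ((1 + ξ) / 2) *
            (∑' n : ℕ, ((n : ℝ) + 1) ^ (-(1 + ξ))) /
          (2 * π ^ ((3 : ℝ) / 2) * (2 + ξ) * Real.Gamma (1 + ξ / 2))| < ε := by
  obtain ⟨hξ0, hξ1⟩ := hξ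
  intro ε hε
  set Z : ℝ := ∑' j : ℤ, |(j : ℝ)| ^ (-(1 + ξ)) with hZ
  have hsum : Summable fun j : ℤ => |(j : ℝ)| ^ (-(1 + ξ)) := summable_abs_int_rpow (by linarith)
  have hZ0 : 0 ≤ Z := tsum_nonneg fun j => by positivity
  set c : ℝ := 1 / (4 * π ^ 2 * L) * L ^ (1 + ξ) with hc
  have hc0 : 0 < c := by positivity
  set δ : ℝ := ε / (c * Z + 1) with hδ
  have hδ0 : 0 < δ := by positivity
  obtain ⟨T, hT⟩ := RL_cos (Gfun p ξ) (Gfun_int hξ0) δ hδ0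
  refine ⟨|T| * L + 1, fun r₁ r₂ hr₁ _ => ?_⟩
  have hr1 : 0 < |r₁| := lt_of_lt_of_le (by positivity) hr₁
  have hr0 : r₁ ≠ 0 := abs_pos.mp hr1
  set e : ℤ → ℝ := fun j => if j = 0 then 0 else
    ∫ x, cos (x * ((j : ℝ) / L * r₁) + (j : ℝ) / L * r₂) * Gfun p ξ x with he
  have heb : ∀ j, |e j| ≤ δ := by
    intro j
    by_cases hj : j = 0
    · simp [he, hj, hδ0.le]
    · simp only [he, hj, if_false]
      apply hT
      rw [abs_mul, abs_div, abs_of_pos hL]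
      have h1 : (1 : ℝ) ≤ |(j : ℝ)| := by exact_mod_cast Int.one_le_abs hj
      rw [div_mul_eq_mul_div, le_div_iff₀ hL]
      have := le_abs_self T
      nlinarith
  set t0 : ℝ := p * |r₁| ^ (1 + ξ) * (√π * (1 / 4) ^ ((1 + ξ) / 2) * |Gamma (-(1 + ξ) / 2)|
      / Gamma (1 + ξ / 2)) with ht0
  have hterm : ∀ j : ℤ, ∫ k₁ : ℝ,
      (1 - cos (k₁ * r₁ + (j : ℝ) / L * r₂)) * Acyl p k₁ ((j : ℝ) / L) 0 0 *
        (k₁ ^ 2 + (j : ℝ) ^ 2 / L ^ 2) ^ (-(2 + ξ) / 2) =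
      (if j = 0 then t0 else 0) + (L ^ (1 + ξ) * Kc p ξ * |(j : ℝ)| ^ (-(1 + ξ)) -
        L ^ (1 + ξ) * (|(j : ℝ)| ^ (-(1 + ξ)) * e j)) := by
    intro j
    by_cases hj : j = 0
    · subst hj
      have := T0 p ξ r₁ hξ0 hξ1 hr0
      have hne : -(1 + ξ) ≠ 0 := by linarith
      simp only [Int.cast_zero, zero_div, zero_mul, add_zero, if_true, abs_zero, zero_rpow hne,
        mul_zero, sub_zero, ne_eq, OfNat.ofNat_ne_zero, not_false_eq_true, zero_pow]
      rw [this]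
    · have hj' : (j : ℝ) ≠ 0 := by exact_mod_cast hj
      have ha : (j : ℝ) / L ≠ 0 := div_ne_zero hj' hL.ne'
      have := Tj p ξ r₁ r₂ hξ0 ((j : ℝ) / L) ha
      rw [← div_pow, this, abs_div, abs_of_pos hL, div_rpow (abs_nonneg _) hL.le,
        rpow_neg hL.le]
      simp only [he, hj, if_false]
      rw [div_inv_eq_mul]
      ring
  have hse : Summable fun j : ℤ => |(j : ℝ)| ^ (-(1 + ξ)) * e j := by
    refine Summable.of_norm_bounded (hsum.mul_right δ) fun j => ?_
    rw [norm_mul, Real.norm_eq_abs, Real.norm_eq_abs, abs_of_nonneg (by positivity)]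
    gcongr
    exact heb j
  set E : ℝ := ∑' j : ℤ, |(j : ℝ)| ^ (-(1 + ξ)) * e j with hE
  have hEb : |E| ≤ Z * δ := by
    have : ‖E‖ ≤ _ := tsum_of_norm_bounded (hsum.hasSum.mul_right δ) (f := fun j : ℤ => |(j : ℝ)| ^ (-(1 + ξ)) * e j) fun j => by
      rw [norm_mul, Real.norm_eq_abs, Real.norm_eq_abs, abs_of_nonneg (by positivity)]
      gcongr
      exact heb j
    exact this
  have hd : dcov p ξ L 0 0 (r₁, r₂) = 1 / (4 * π ^ 2 * L) *
      (t0 + (L ^ (1 + ξ) * Kc p ξ * Z - L ^ (1 + ξ) * E)) := by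
    unfold dcov
    congr 1
    simp_rw [hterm]
    have h1 : HasSum (fun j : ℤ => if j = 0 then t0 else 0) t0 := hasSum_ite_eq 0 t0
    exact (h1.add ((hsum.hasSum.mul_left _).sub (hse.hasSum.mul_left _))).tsum_eq
  have hpi : π ^ ((3 : ℝ) / 2) = π * √π := by
    rw [sqrt_eq_rpow, ← rpow_one_add' pi_nonneg (by norm_num)]; norm_num
  have hsq : √π * √π = π := mul_self_sqrt pi_nonneg
  have h4 : ((1 : ℝ) / 4) ^ ((1 + ξ) / 2) = 4 / 2 ^ (3 + ξ) := by
    rw [show (1 : ℝ) / 4 = 2 ^ (-2 : ℝ) by rw [rpow_neg (by norm_num)]; norm_num,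
      ← rpow_mul (by norm_num), show (-2 : ℝ) * ((1 + ξ) / 2) = 2 - (3 + ξ) by ring,
      rpow_sub (by norm_num)]
    norm_num
  have hLx : L ^ (1 + ξ) = L * L ^ ξ := by rw [rpow_add hL, rpow_one]
  have hG : Gamma (1 + ξ / 2) ≠ 0 := (Gamma_pos_of_pos (by linarith)).ne'
  have hsp : 0 < √π := sqrt_pos.mpr pi_pos
  have h2ξ : 2 + ξ ≠ 0 := by linarith
  have hA : 1 / (4 * π ^ 2 * L) * t0 = p * |Real.Gamma (-(1 + ξ) / 2)| /
            ((2 : ℝ) ^ (3 + ξ) * π ^ ((3 : ℝ) / 2) * Real.Gamma (1 + ξ / 2) * L) *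
            |r₁| ^ (1 + ξ) := by
    rw [ht0, hpi, h4]
    have : (2:ℝ) ^ (3 + ξ) ≠ 0 := by positivity
    field_simp
    rw [sq_sqrt pi_nonneg]
    ring
  have hB : 1 / (4 * π ^ 2 * L) * (L ^ (1 + ξ) * Kc p ξ * Z) =
      (1 + (1 - p) * ξ) * L ^ ξ * Real.Gamma ((1 + ξ) / 2) *
            (∑' n : ℕ, ((n : ℝ) + 1) ^ (-(1 + ξ))) /
          (2 * π ^ ((3 : ℝ) / 2) * (2 + ξ) * Real.Gamma (1 + ξ / 2)) := by
    rw [hZ, Zsum (by linarith), hpi, hLx]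
    unfold Kc
    field_simp
    rw [sq_sqrt pi_nonneg]
    ring
  rw [hd, ← hA, ← hB]
  rw [show 1 / (4 * π ^ 2 * L) * (t0 + (L ^ (1 + ξ) * Kc p ξ * Z - L ^ (1 + ξ) * E)) -
    1 / (4 * π ^ 2 * L) * t0 - 1 / (4 * π ^ 2 * L) * (L ^ (1 + ξ) * Kc p ξ * Z) = -(c * E) by
      rw [hc]; ring]
  rw [abs_neg, abs_mul, abs_of_pos hc0]
  calc c * |E| ≤ c * (Z * δ) := by gcongr
    _ < (c * Z + 1) * δ := by nlinarith
    _ = ε := by rw [hδ]; field_simp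
end

section
/- Fix ξ ∈ (0,1), ℘ ∈ [0,1], and L > 0. Set 𝔇₂ = (1−℘) |Γ(−(1+ξ)/2)| / (2^{3+ξ} π^{3/2} Γ(1+ξ/2) L) and ϰ₂ = (1+℘ξ) L^{ξ} Γ((1+ξ)/2) ζ(1+ξ) / (2 π^{3/2} (2+ξ) Γ(1+ξ/2)), where ζ is the Riemann zeta function. Then d₂₂(r) − 𝔇₂ |r₁|^{1+ξ} → ϰ₂ as |r₁| → ∞, uniformly in r₂ ∈ [−πL, πL). -/
open MeasureTheory Real

lemma key (φ : ℝ → ℝ) (hφc : Continuous φ) (hφ0 : ∀ k, 0 ≤ φ k) (a m : ℝ) (ha : 0 < a)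
    (Φ : ℝ → ℝ) (hi : ∀ t, 0 < t → Integrable (fun k => φ k * exp (-t * k ^ 2)))
    (hΦ : ∀ t, 0 < t → ∫ k, φ k * exp (-t * k ^ 2) = Φ t)
    (hint : IntegrableOn (fun t => t ^ (a - 1) * exp (-t * m ^ 2) * Φ t) (Set.Ioi 0)) :
    Integrable (fun k => φ k * (k ^ 2 + m ^ 2) ^ (-a)) ∧
    ∫ k, φ k * (k ^ 2 + m ^ 2) ^ (-a) =
      1 / Gamma a * ∫ t in Set.Ioi 0, t ^ (a - 1) * exp (-t * m ^ 2) * Φ t := by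
  set F : ℝ → ℝ → ℝ := fun t k => t ^ (a - 1) * exp (-t * m ^ 2) * (φ k * exp (-t * k ^ 2)) with hF
  have hFm : AEStronglyMeasurable (Function.uncurry F)
      ((volume.restrict (Set.Ioi (0:ℝ))).prod volume) := by
    apply Measurable.aestronglyMeasurable
    have := hφc.measurable
    simp only [hF, Function.uncurry_def]
    fun_prop
  have hFn : ∀ t, 0 < t → ∀ k, ‖F t k‖ = F t k := by
    intro t ht k
    have := hφ0 k
    exact Real.norm_of_nonneg (by simp only [hF]; positivity)
  have hFint : ∀ t, 0 < t → ∫ k, F t k = t ^ (a - 1) * exp (-t * m ^ 2) * Φ t := by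
    intro t ht
    simp only [hF]
    rw [integral_const_mul, hΦ t ht]
  have hFI : Integrable (Function.uncurry F)
      ((volume.restrict (Set.Ioi (0:ℝ))).prod volume) := by
    rw [integrable_prod_iff hFm]
    constructor
    · filter_upwards [ae_restrict_mem measurableSet_Ioi] with t ht
      exact (hi t ht).const_mul (t ^ (a - 1) * exp (-t * m ^ 2))
    · refine hint.congr ?_
      filter_upwards [ae_restrict_mem measurableSet_Ioi] with t ht
      simp only [Function.uncurry]
      rw [← hFint t ht]
      exact integral_congr_ae (Filter.Eventually.of_forall fun k => (hFn t ht k).symm)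
  have hk : ∀ᵐ k : ℝ, ∫ t in Set.Ioi 0, F t k = Gamma a * (φ k * (k ^ 2 + m ^ 2) ^ (-a)) := by
    have h0 : ∀ᵐ k : ℝ, k ≠ 0 := by simp [ae_iff]
    filter_upwards [h0] with k hk
    have hpos : 0 < k ^ 2 + m ^ 2 := by positivity
    have := Real.integral_rpow_mul_exp_neg_mul_Ioi ha hpos
    calc _ = ∫ t in Set.Ioi 0, φ k * (t ^ (a - 1) * exp (-((k ^ 2 + m ^ 2) * t))) := by
            congr 1; ext t; simp only [hF]
            rw [show -((k ^ 2 + m ^ 2) * t) = -t * m ^ 2 + -t * k ^ 2 by ring, exp_add]; ring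
      _ = _ := by
        rw [integral_const_mul, this, one_div, Real.inv_rpow hpos.le, Real.rpow_neg hpos.le]; ring
  have hG := Real.Gamma_pos_of_pos ha
  have hI2 := hFI.integral_prod_right
  have hI3 : Integrable (fun k => Gamma a * (φ k * (k ^ 2 + m ^ 2) ^ (-a))) := hI2.congr hk
  refine ⟨?_, ?_⟩
  · have := hI3.const_mul (Gamma a)⁻¹
    simpa [← mul_assoc, inv_mul_cancel₀ hG.ne'] using this
  · have h1 := integral_integral_swap hFI
    rw [integral_congr_ae hk, integral_const_mul] at h1
    rw [setIntegral_congr_fun measurableSet_Ioi (fun t ht => hFint t ht)] at h1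
    rw [h1]; field_simp

lemma gaussInt (t : ℝ) (ht : 0 < t) (r : ℝ) :
    Integrable (fun k => Real.cos (k * r) * exp (-t * k ^ 2)) := by
  refine (integrable_exp_neg_mul_sq ht).mono' (by fun_prop) (Filter.Eventually.of_forall fun k => ?_)
  rw [norm_mul, Real.norm_eq_abs, Real.norm_eq_abs, abs_of_pos (exp_pos _)]
  exact mul_le_of_le_one_left (exp_pos _).le (abs_cos_le_one _)

lemma gaussCos (t : ℝ) (ht : 0 < t) (r : ℝ) :
    ∫ k, Real.cos (k * r) * exp (-t * k ^ 2) = √(π / t) * exp (-(r ^ 2 / 4 * t⁻¹)) := by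
  have h := fourierIntegral_gaussian (b := (t:ℂ)) (by simpa using ht) (r : ℂ)
  have hi : Integrable (fun k : ℝ => Complex.exp (Complex.I * r * k) * Complex.exp (-t * k ^ 2)) := by
    refine (integrable_exp_neg_mul_sq ht).mono' (by fun_prop) (Filter.Eventually.of_forall fun k => ?_)
    rw [norm_mul, Complex.norm_exp, Complex.norm_exp]
    simp [← Complex.ofReal_pow]
  have h2 := congrArg Complex.re h
  rw [← RCLike.re_eq_complex_re, ← integral_re hi] at h2
  rw [show (fun k => Real.cos (k * r) * exp (-t * k ^ 2)) = fun k : ℝ => RCLike.re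
    (Complex.exp (Complex.I * r * k) * Complex.exp (-t * k ^ 2)) from ?_, h2]
  · rw [RCLike.re_eq_complex_re, Real.sqrt_eq_rpow]
    rw [show (π / t : ℂ) ^ (1/2 : ℂ) = (((π / t) ^ (1/2 : ℝ) : ℝ) : ℂ) by
      rw [Complex.ofReal_cpow (by positivity)]; push_cast; rfl]
    rw [show -(r:ℂ) ^ 2 / (4 * t) = ((-(r ^ 2 / 4 * t⁻¹) : ℝ) : ℂ) by push_cast; field_simp]
    rw [← Complex.ofReal_exp, ← Complex.ofReal_mul, Complex.ofReal_re]
  · ext k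
    rw [RCLike.re_eq_complex_re, ← Complex.exp_add,
      show Complex.I * r * k + -t * k ^ 2 = ((-t * k ^ 2 : ℝ) : ℂ) + ((k * r : ℝ) : ℂ) * Complex.I by
        push_cast; ring, Complex.exp_re]
    rw [Complex.add_re, Complex.add_im, Complex.re_ofReal_mul, Complex.im_ofReal_mul,
      Complex.I_re, Complex.I_im, Complex.ofReal_re, Complex.ofReal_im, mul_zero, add_zero, mul_one,
      zero_add, mul_comm]

lemma intB (σ b : ℝ) (h0 : 0 < σ) (h1 : σ < 1) (hb : 0 < b) :
    IntegrableOn (fun u => u ^ (-σ - 1) * (1 - exp (-(b * u)))) (Set.Ioi 0) := by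
  have hm : Measurable (fun u : ℝ => u ^ (-σ - 1) * (1 - exp (-(b * u)))) := by fun_prop
  rw [← Set.Ioc_union_Ioi_eq_Ioi (zero_le_one : (0:ℝ) ≤ 1)]
  refine IntegrableOn.union ?_ ?_
  · have h : IntegrableOn (fun u : ℝ => b * u ^ (-σ)) (Set.Ioc 0 1) := by
      have := intervalIntegral.intervalIntegrable_rpow' (a := 0) (b := 1) (r := -σ) (by linarith)
      rw [intervalIntegrable_iff_integrableOn_Ioc_of_le zero_le_one] at this
      exact this.const_mul b
    refine h.mono' hm.aestronglyMeasurable ?_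
    filter_upwards [ae_restrict_mem measurableSet_Ioc] with u hu
    have hu0 : 0 < u := hu.1
    have e1 : 1 - exp (-(b * u)) ≤ b * u := by linarith [add_one_le_exp (-(b * u))]
    have e2 : 0 ≤ 1 - exp (-(b * u)) := by
      have : exp (-(b*u)) ≤ 1 := exp_le_one_iff.2 (by nlinarith)
      linarith
    rw [Real.norm_of_nonneg (by positivity)]
    calc _ ≤ u ^ (-σ - 1) * (b * u) := by gcongr
      _ = _ := by rw [rpow_sub_one hu0.ne']; field_simp
  · have h : IntegrableOn (fun u : ℝ => u ^ (-σ - 1)) (Set.Ioi 1) :=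
      integrableOn_Ioi_rpow_of_lt (by linarith) one_pos
    refine h.mono' hm.aestronglyMeasurable ?_
    filter_upwards [ae_restrict_mem measurableSet_Ioi] with u hu
    have hu0 : 0 < u := one_pos.trans hu
    have e2 : 0 ≤ 1 - exp (-(b * u)) := by
      have : exp (-(b*u)) ≤ 1 := exp_le_one_iff.2 (by nlinarith)
      linarith
    rw [Real.norm_of_nonneg (by positivity)]
    exact mul_le_of_le_one_right (by positivity) (by linarith [exp_pos (-(b*u))])

lemma valB (σ b : ℝ) (h0 : 0 < σ) (h1 : σ < 1) (hb : 0 < b) :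
    ∫ u in Set.Ioi 0, u ^ (-σ - 1) * (1 - exp (-(b * u))) = b ^ σ * |Gamma (-σ)| := by
  have hI := intB σ b h0 h1 hb
  have hI2 : IntegrableOn (fun u : ℝ => u ^ (-σ) * exp (-(b * u))) (Set.Ioi 0) := by
    have := integrableOn_rpow_mul_exp_neg_mul_rpow (p := 1) (s := -σ) (b := b) (by linarith) one_pos hb
    simpa using this
  have hV := Real.integral_rpow_mul_exp_neg_mul_Ioi (a := 1 - σ) (r := b) (by linarith) hb
  rw [show 1 - σ - 1 = -σ by ring] at hV
  set G : ℝ → ℝ := fun u => -(1 / σ) * (u ^ (-σ) * (1 - exp (-(b * u)))) with hG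
  have hd : ∀ u ∈ Set.Ioi (0:ℝ), HasDerivAt G
      (u ^ (-σ - 1) * (1 - exp (-(b * u))) - b / σ * (u ^ (-σ) * exp (-(b * u)))) u := by
    intro u hu
    have hu : 0 < u := hu
    have d1 : HasDerivAt (fun u : ℝ => u ^ (-σ)) (-σ * u ^ (-σ - 1)) u :=
      Real.hasDerivAt_rpow_const (Or.inl hu.ne')
    have d2 : HasDerivAt (fun u : ℝ => 1 - exp (-(b * u))) (-(exp (-(b * u)) * (-(b * 1)))) u :=
      ((((hasDerivAt_id u).const_mul b).neg).exp).const_sub 1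
    refine ((d1.mul d2).const_mul (-(1 / σ))).congr_deriv ?_
    field_simp
    ring
  have hb0 : ∀ u : ℝ, 0 < u → 0 ≤ 1 - exp (-(b * u)) := by
    intro u hu
    have : exp (-(b*u)) ≤ 1 := exp_le_one_iff.2 (by nlinarith)
    linarith
  have hG0 : G 0 = 0 := by simp [hG]
  have hc : ContinuousWithinAt G (Set.Ici 0) 0 := by
    rw [← continuousWithinAt_Ioi_iff_Ici]
    unfold ContinuousWithinAt
    rw [hG0]
    have hl : Filter.Tendsto (fun u : ℝ => 1 / σ * (b * u ^ (1 - σ))) (nhdsWithin 0 (Set.Ioi 0)) (nhds 0) := by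
      have : ContinuousAt (fun u : ℝ => 1 / σ * (b * u ^ (1 - σ))) 0 := by
        have := Real.continuousAt_rpow_const 0 (1 - σ) (Or.inr (by linarith))
        fun_prop
      have h := this.tendsto
      rw [Real.zero_rpow (by linarith), mul_zero, mul_zero] at h
      exact h.mono_left nhdsWithin_le_nhds
    refine squeeze_zero_norm' ?_ hl
    filter_upwards [self_mem_nhdsWithin] with u hu
    have hu : 0 < u := hu
    have e1 : 1 - exp (-(b * u)) ≤ b * u := by linarith [add_one_le_exp (-(b * u))]
    have e2 := hb0 u hu
    simp only [hG]
    rw [norm_mul, norm_neg, Real.norm_of_nonneg (by positivity), Real.norm_of_nonneg (by positivity)]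
    refine mul_le_mul_of_nonneg_left ?_ (by positivity)
    calc _ ≤ u ^ (-σ) * (b * u) := by gcongr
      _ = _ := by rw [show 1 - σ = -σ + 1 by ring, rpow_add_one hu.ne']; ring
  have ht : Filter.Tendsto G Filter.atTop (nhds 0) := by
    have hl : Filter.Tendsto (fun u : ℝ => 1 / σ * u ^ (-σ)) Filter.atTop (nhds 0) := by
      simpa using (tendsto_rpow_neg_atTop h0).const_mul (1 / σ)
    refine squeeze_zero_norm' ?_ hl
    filter_upwards [Filter.eventually_gt_atTop 0] with u hu
    have e2 := hb0 u hu
    simp only [hG]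
    rw [norm_mul, norm_neg, Real.norm_of_nonneg (by positivity), Real.norm_of_nonneg (by positivity)]
    gcongr
    exact mul_le_of_le_one_right (by positivity) (by linarith [exp_pos (-(b*u))])
  have := integral_Ioi_of_hasDerivAt_of_tendsto hc hd (hI.sub (hI2.const_mul (b / σ))) ht
  rw [hG0, integral_sub hI (hI2.const_mul (b / σ)), integral_const_mul, hV] at this
  have hGam : Gamma (1 - σ) = -σ * Gamma (-σ) := by
    rw [← Real.Gamma_add_one (by linarith)]; ring_nf
  have hp := Real.Gamma_pos_of_pos (show 0 < 1 - σ by linarith)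
  have hneg : Gamma (-σ) < 0 := by
    rw [hGam] at hp
    by_contra hh
    push Not at hh
    nlinarith [mul_nonneg h0.le hh]
  rw [abs_of_neg hneg]
  rw [hGam, one_div, Real.inv_rpow hb.le, Real.rpow_sub hb, rpow_one] at this
  have hbs : b ^ σ ≠ 0 := (rpow_pos_of_pos hb _).ne'
  field_simp at this
  linarith

lemma subB (σ b : ℝ) (h0 : 0 < σ) (h1 : σ < 1) (hb : 0 < b) :
    IntegrableOn (fun t => t ^ (σ - 1) * (1 - exp (-(b * t⁻¹)))) (Set.Ioi 0) ∧
    ∫ t in Set.Ioi 0, t ^ (σ - 1) * (1 - exp (-(b * t⁻¹))) = b ^ σ * |Gamma (-σ)| := by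
  have e : Set.EqOn (fun x : ℝ => (|(-1:ℝ)| * x ^ ((-1:ℝ) - 1)) •
      ((fun u : ℝ => u ^ (-σ - 1) * (1 - exp (-(b * u)))) (x ^ (-1:ℝ))))
      (fun t => t ^ (σ - 1) * (1 - exp (-(b * t⁻¹)))) (Set.Ioi 0) := by
    intro x hx
    have hx : 0 < x := hx
    simp only [abs_neg, abs_one, one_mul, smul_eq_mul]
    rw [← Real.rpow_mul hx.le, ← mul_assoc, ← Real.rpow_add hx, Real.rpow_neg_one]
    ring_nf
  constructor
  · have h := (integrableOn_Ioi_comp_rpow_iff (fun u : ℝ => u ^ (-σ - 1) * (1 - exp (-(b * u))))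
      (p := -1) (by norm_num)).2 (intB σ b h0 h1 hb)
    exact (integrableOn_congr_fun e measurableSet_Ioi).1 h
  · rw [← valB σ b h0 h1 hb, ← integral_comp_rpow_Ioi (fun u : ℝ => u ^ (-σ - 1) * (1 - exp (-(b * u)))) (p := -1) (by norm_num)]
    exact (setIntegral_congr_fun measurableSet_Ioi e).symm

lemma zeroMode (ξ r : ℝ) (h0 : 0 < ξ) (h1 : ξ < 1) (hr : r ≠ 0) :
    ∫ k, (1 - Real.cos (k * r)) * (k ^ 2) ^ (-(2 + ξ) / 2) =
      √π * |Gamma (-(1 + ξ) / 2)| / (2 ^ (1 + ξ) * Gamma (1 + ξ / 2)) * |r| ^ (1 + ξ) := by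
  obtain ⟨hs1, hs2⟩ := subB ((1 + ξ) / 2) (r ^ 2 / 4) (by linarith) (by linarith) (by positivity)
  have hcong : Set.EqOn (fun t : ℝ => √π * (t ^ ((1 + ξ) / 2 - 1) * (1 - exp (-(r ^ 2 / 4 * t⁻¹)))))
      (fun t => t ^ ((1 + ξ / 2) - 1) * exp (-t * (0:ℝ) ^ 2) *
        (√(π / t) * (1 - exp (-(r ^ 2 / 4 * t⁻¹))))) (Set.Ioi 0) := by
    intro t ht
    have ht : 0 < t := ht
    have : t ^ ((1 + ξ) / 2 - 1) = t ^ ((1 + ξ / 2) - 1) * (√t)⁻¹ := by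
      rw [Real.sqrt_eq_rpow, ← Real.rpow_neg ht.le, ← Real.rpow_add ht]; ring_nf
    simp only [this, Real.sqrt_div pi_pos.le]
    simp
    ring
  have := (key (fun k => 1 - Real.cos (k * r)) (by fun_prop)
    (fun k => by linarith [Real.cos_le_one (k * r)]) (1 + ξ / 2) 0 (by linarith)
    (fun t => √(π / t) * (1 - exp (-(r ^ 2 / 4 * t⁻¹)))) ?_ ?_ ?_).2
  · rw [← setIntegral_congr_fun measurableSet_Ioi hcong, integral_const_mul, hs2] at this
    have e : (r ^ 2 / 4) ^ ((1 + ξ) / 2) = |r| ^ (1 + ξ) / 2 ^ (1 + ξ) := by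
      rw [← Real.div_rpow (abs_nonneg r) (by norm_num), show r ^ 2 / 4 = (|r| / 2) ^ 2 by
        rw [div_pow, sq_abs]; norm_num, ← Real.rpow_natCast, ← Real.rpow_mul (by positivity)]
      congr 1; push_cast; ring
    rw [e] at this
    simp only [show -(2 + ξ) / 2 = -(1 + ξ / 2) by ring, show -(1 + ξ) / 2 = -((1 + ξ) / 2) by ring]
    simp only [ne_eq, OfNat.ofNat_ne_zero, not_false_eq_true, zero_pow, add_zero] at this
    rw [this]
    field_simp
  · intro t ht
    have := (integrable_exp_neg_mul_sq ht).sub (gaussInt t ht r)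
    refine this.congr (Filter.Eventually.of_forall fun k => ?_)
    simp only [Pi.sub_apply]; ring
  · intro t ht
    have : ∀ k, (1 - Real.cos (k * r)) * exp (-t * k ^ 2) =
      exp (-t * k ^ 2) - Real.cos (k * r) * exp (-t * k ^ 2) := fun k => by ring
    simp only [this]
    rw [integral_sub (integrable_exp_neg_mul_sq ht) (gaussInt t ht r), gaussCos t ht r,
      integral_gaussian]
    ring
  · exact (integrableOn_congr_fun hcong measurableSet_Ioi).1 (hs1.const_mul (√π))

lemma massive (a m : ℝ) (ha : 1 / 2 < a) (hm : m ≠ 0) :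
    Integrable (fun k => (k ^ 2 + m ^ 2) ^ (-a)) ∧
    ∫ k, (k ^ 2 + m ^ 2) ^ (-a) = √π * Gamma (a - 1 / 2) / Gamma a * (m ^ 2) ^ (1 / 2 - a) := by
  have hm2 : 0 < m ^ 2 := by positivity
  have hcong : Set.EqOn (fun t : ℝ => √π * (t ^ ((a - 1 / 2) - 1) * exp (-(m ^ 2 * t))))
      (fun t => t ^ (a - 1) * exp (-t * m ^ 2) * √(π / t)) (Set.Ioi 0) := by
    intro t ht
    have ht : 0 < t := ht
    have : t ^ ((a - 1 / 2) - 1) = t ^ (a - 1) * (√t)⁻¹ := by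
      rw [Real.sqrt_eq_rpow, ← Real.rpow_neg ht.le, ← Real.rpow_add ht]; ring_nf
    simp only [this, Real.sqrt_div pi_pos.le]
    rw [show -t * m ^ 2 = -(m ^ 2 * t) by ring]
    ring
  have hV := Real.integral_rpow_mul_exp_neg_mul_Ioi (a := a - 1 / 2) (r := m ^ 2) (by linarith) hm2
  have hI : IntegrableOn (fun t : ℝ => t ^ ((a - 1 / 2) - 1) * exp (-(m ^ 2 * t))) (Set.Ioi 0) := by
    have := integrableOn_rpow_mul_exp_neg_mul_rpow (p := 1) (s := (a - 1 / 2) - 1) (b := m ^ 2)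
      (by linarith) one_pos hm2
    simpa using this
  have := key (fun k => 1) (by fun_prop) (fun k => zero_le_one) a m (by linarith)
    (fun t => √(π / t)) (fun t ht => by simpa using integrable_exp_neg_mul_sq ht)
    (fun t ht => by simpa using integral_gaussian t)
    ((integrableOn_congr_fun hcong measurableSet_Ioi).1 (hI.const_mul (√π)))
  rw [← setIntegral_congr_fun measurableSet_Ioi hcong, integral_const_mul (√π), hV] at this
  simp only [one_mul] at this
  refine ⟨this.1, this.2.trans ?_⟩
  rw [show 1 / 2 - a = -(a - 1 / 2) by ring, Real.rpow_neg hm2.le, one_div (m ^ 2),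
    Real.inv_rpow hm2.le]
  field_simp

lemma riemLeb (g : ℝ → ℝ) (hg : Integrable g) (hg0 : ∀ k, 0 ≤ g k) :
    ∃ N : ℝ → ℝ, Filter.Tendsto N (Filter.cocompact ℝ) (nhds 0) ∧ (∀ r, 0 ≤ N r) ∧
      (∀ r, N r ≤ ∫ k, g k) ∧
      ∀ r θ : ℝ, |∫ k, Real.cos (k * r + θ) * g k| ≤ N r := by
  have hgc : Integrable (fun k => (g k : ℂ)) := hg.ofReal
  refine ⟨fun r => ‖∫ k : ℝ, (Real.fourierChar (-(k * (r * (-(2 * π))⁻¹)))) • (g k : ℂ)‖, ?_, fun r => norm_nonneg _, ?_, ?_⟩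
  · have h := (Real.tendsto_integral_exp_smul_cocompact (fun k => (g k : ℂ))).norm
    rw [norm_zero] at h
    have h2 : Filter.Tendsto (fun r : ℝ => r * (-(2 * π))⁻¹) (Filter.cocompact ℝ) (Filter.cocompact ℝ) :=
      Filter.tendsto_cocompact_mul_right₀ (by simp [pi_ne_zero])
    exact h.comp h2
  · intro r
    refine (norm_integral_le_integral_norm _).trans (le_of_eq ?_)
    congr 1; ext k
    rw [Circle.norm_smul, Complex.norm_real, Real.norm_of_nonneg (hg0 k)]
  · intro r θ
    have hi : Integrable (fun k : ℝ => (Real.fourierChar (-(k * (r * (-(2 * π))⁻¹)))) • (g k : ℂ)) := by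
      refine hgc.mono ?_ (Filter.Eventually.of_forall fun k => by rw [Circle.norm_smul])
      refine AEStronglyMeasurable.smul ?_ hgc.aestronglyMeasurable
      exact (continuous_subtype_val.comp (by fun_prop :
        Continuous fun k : ℝ => Real.fourierChar (-(k * (r * (-(2 * π))⁻¹))))).aestronglyMeasurable
    have hi2 := hi.const_mul (Complex.exp (θ * Complex.I))
    have e : ∀ k, Real.cos (k * r + θ) * g k = RCLike.re (Complex.exp (θ * Complex.I) *
        ((Real.fourierChar (-(k * (r * (-(2 * π))⁻¹)))) • (g k : ℂ))) := by
      intro k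
      rw [Circle.smul_def, Real.fourierChar_apply, smul_eq_mul, ← mul_assoc, ← Complex.exp_add,
        RCLike.re_eq_complex_re, Complex.re_mul_ofReal]
      have : 2 * π * -(k * (r * (-(2 * π))⁻¹)) = k * r := by
        field_simp
      rw [this, ← add_mul, ← Complex.ofReal_add, Complex.exp_ofReal_mul_I_re, add_comm]
    simp only [e]
    rw [integral_re hi2, integral_const_mul]
    refine (RCLike.abs_re_le_norm _).trans ?_
    rw [norm_mul, Complex.norm_exp_ofReal_mul_I, one_mul]

/-- The constant in the massive-mode integral. -/
noncomputable def Cm (p ξ : ℝ) : ℝ :=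
  √π * Gamma ((1 + ξ) / 2) / Gamma (1 + ξ / 2) * ((1 + p * ξ) / (2 + ξ))

/-- One mode of the spectral density. -/
noncomputable def gm (p ξ L : ℝ) (j : ℤ) (k : ℝ) : ℝ :=
  Acyl p k ((j : ℝ) / L) 1 1 * (k ^ 2 + (j : ℝ) ^ 2 / L ^ 2) ^ (-(2 + ξ) / 2)

lemma gm_nonneg (p ξ L : ℝ) (hp : p ∈ Set.Icc (0 : ℝ) 1) (j : ℤ) (k : ℝ) : 0 ≤ gm p ξ L j k := by
  unfold gm Acyl
  refine mul_nonneg ?_ (by positivity)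
  simp only [if_true, Matrix.cons_val_one, Matrix.cons_val_fin_one, mul_one]
  set m : ℝ := (j : ℝ) / L
  obtain ⟨h0, h1⟩ := hp
  rcases eq_or_ne (k ^ 2 + m ^ 2) 0 with h | h
  · rw [h]; simp; linarith
  · have hpos : 0 < k ^ 2 + m ^ 2 := lt_of_le_of_ne (by positivity) h.symm
    have : (1 - p) + (2 * p - 1) * (m * m) / (k ^ 2 + m ^ 2)
      = ((1 - p) * k ^ 2 + p * m ^ 2) / (k ^ 2 + m ^ 2) := by field_simp; ring
    rw [this]
    have : 0 ≤ 1 - p := by linarith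
    positivity

lemma gm_int (p ξ L : ℝ) (hξ : ξ ∈ Set.Ioo (0 : ℝ) 1) (hL : 0 < L) (j : ℤ) (hj : j ≠ 0) :
    Integrable (gm p ξ L j) ∧ ∫ k, gm p ξ L j k = Cm p ξ * L ^ (1 + ξ) * |(j : ℝ)| ^ (-(1 + ξ)) := by
  obtain ⟨h0, h1⟩ := hξ
  have hj' : (j : ℝ) ≠ 0 := by exact_mod_cast hj
  have hm : (j : ℝ) / L ≠ 0 := by positivity
  have e : gm p ξ L j = fun k => (1 - p) * (k ^ 2 + ((j : ℝ) / L) ^ 2) ^ (-(1 + ξ / 2)) +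
      (2 * p - 1) * ((j : ℝ) / L) ^ 2 * (k ^ 2 + ((j : ℝ) / L) ^ 2) ^ (-(2 + ξ / 2)) := by
    ext k
    unfold gm Acyl
    simp only [if_true, Matrix.cons_val_one, Matrix.cons_val_fin_one, mul_one]
    rw [← div_pow]
    set m : ℝ := (j : ℝ) / L
    have hpos : 0 < k ^ 2 + m ^ 2 := by positivity
    rw [show -(2 + ξ / 2) = -(1 + ξ / 2) - 1 by ring, Real.rpow_sub_one hpos.ne',
      show -(2 + ξ) / 2 = -(1 + ξ / 2) by ring]
    ring
  obtain ⟨i1, v1⟩ := massive (1 + ξ / 2) _ (by linarith) hm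
  obtain ⟨i2, v2⟩ := massive (2 + ξ / 2) _ (by linarith) hm
  have hm2 : 0 < ((j : ℝ) / L) ^ 2 := by positivity
  rw [e]
  refine ⟨(i1.const_mul _).add (i2.const_mul _), ?_⟩
  rw [integral_add (i1.const_mul _) (i2.const_mul _), integral_const_mul, integral_const_mul, v1, v2]
  have g1 : Gamma (2 + ξ / 2) = (1 + ξ / 2) * Gamma (1 + ξ / 2) := by
    rw [← Real.Gamma_add_one (by linarith)]; ring_nf
  have g2 : Gamma (2 + ξ / 2 - 1 / 2) = ((1 + ξ) / 2) * Gamma ((1 + ξ) / 2) := by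
    rw [← Real.Gamma_add_one (by linarith)]; ring_nf
  have g3 : 0 < Gamma (1 + ξ / 2) := Real.Gamma_pos_of_pos (by linarith)
  have e2 : (((j : ℝ) / L) ^ 2) ^ (1 / 2 - (1 + ξ / 2)) = L ^ (1 + ξ) * |(j : ℝ)| ^ (-(1 + ξ)) := by
    have : ((j : ℝ) / L) ^ 2 = (|(j:ℝ)| / L) ^ (2 : ℝ) := by
      rw [Real.rpow_two, div_pow, div_pow, sq_abs]
    rw [this, ← Real.rpow_mul (by positivity), Real.div_rpow (abs_nonneg _) hL.le,
      show 2 * (1 / 2 - (1 + ξ / 2)) = -(1 + ξ) by ring, Real.rpow_neg hL.le (1 + ξ)]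
    field_simp
  have e3 : (((j : ℝ) / L) ^ 2) ^ (1 / 2 - (2 + ξ / 2)) =
      (((j : ℝ) / L) ^ 2) ^ (1 / 2 - (1 + ξ / 2)) / ((j : ℝ) / L) ^ 2 := by
    rw [← Real.rpow_sub_one hm2.ne']; ring_nf
  rw [e3, e2, g1, g2, show 1 + ξ / 2 - 1 / 2 = (1 + ξ) / 2 by ring]
  unfold Cm
  rw [mul_assoc _ (L ^ (1 + ξ))]
  generalize L ^ (1 + ξ) * |(j : ℝ)| ^ (-(1 + ξ)) = X at *
  have : 2 + ξ ≠ 0 := by linarith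
  have : 1 + ξ / 2 ≠ 0 := by linarith
  generalize Gamma ((1 + ξ) / 2) = G1
  field_simp
  ring

lemma zsum (ξ : ℝ) (h0 : 0 < ξ) :
    HasSum (fun j : ℤ => if j = 0 then (0:ℝ) else |(j : ℝ)| ^ (-(1 + ξ)))
      (2 * ∑' n : ℕ, ((n : ℝ) + 1) ^ (-(1 + ξ))) := by
  have hs : Summable (fun n : ℕ => ((n : ℝ) + 1) ^ (-(1 + ξ))) := by
    have := (summable_nat_add_iff 1).2 (Real.summable_nat_rpow.2 (show -(1 + ξ) < -1 by linarith))
    simpa using this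
  have h := hs.hasSum
  have h1 : ∀ n : ℕ, ((n:ℤ) + 1 ≠ 0) := fun n => by omega
  have h2 : ∀ n : ℕ, (-((n:ℤ) + 1) ≠ 0) := fun n => by omega
  have h3 : ∀ n : ℕ, |(n:ℝ) + 1| = n + 1 := fun n => abs_of_pos (by positivity)
  have := HasSum.of_add_one_of_neg_add_one
    (f := fun j : ℤ => if j = 0 then (0:ℝ) else |(j : ℝ)| ^ (-(1 + ξ)))
    (m := ∑' n : ℕ, ((n : ℝ) + 1) ^ (-(1 + ξ))) (m' := ∑' n : ℕ, ((n : ℝ) + 1) ^ (-(1 + ξ)))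
    ?_ ?_
  · convert this using 1
    simp; ring
  · simp only [h1, if_false]; push_cast; simp only [h3]; exact h
  · simp only [h2, if_false]; push_cast; simp only [abs_neg, h3]
    have h4 : ∀ n : ℕ, |-1 + -(n:ℝ)| = n + 1 := fun n => by
      rw [show -1 + -(n:ℝ) = -(n + 1) by ring, abs_neg, h3]
    try simp only [h4]
    exact h

/-- For `ξ ∈ (0,1)`, `℘ ∈ [0,1]`, `L > 0`, with
`𝔇₂ = (1−℘) |Γ(−(1+ξ)/2)| / (2^{3+ξ} π^{3/2} Γ(1+ξ/2) L)` and
`ϰ₂ = (1+℘ξ) L^ξ Γ((1+ξ)/2) ζ(1+ξ) / (2 π^{3/2} (2+ξ) Γ(1+ξ/2))` (where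
`ζ(1+ξ) = ∑_{n≥1} n^{−(1+ξ)}`), one has `d₂₂(r) − 𝔇₂|r₁|^{1+ξ} → ϰ₂` as `|r₁| → ∞`, uniformly
in `r₂ ∈ [−πL, πL)`. -/
theorem stmt_11 (ξ p L : ℝ) (hξ : ξ ∈ Set.Ioo (0 : ℝ) 1) (hp : p ∈ Set.Icc (0 : ℝ) 1)
    (hL : 0 < L) :
    ∀ ε : ℝ, 0 < ε → ∃ M : ℝ, ∀ r₁ r₂ : ℝ, M ≤ |r₁| → r₂ ∈ Set.Ico (-(π * L)) (π * L) →
      |dcov p ξ L 1 1 (r₁, r₂) -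
          (1 - p) * |Real.Gamma (-(1 + ξ) / 2)| /
            ((2 : ℝ) ^ (3 + ξ) * π ^ ((3 : ℝ) / 2) * Real.Gamma (1 + ξ / 2) * L) *
            |r₁| ^ (1 + ξ) -
        (1 + p * ξ) * L ^ ξ * Real.Gamma ((1 + ξ) / 2) *
            (∑' n : ℕ, ((n : ℝ) + 1) ^ (-(1 + ξ))) /
          (2 * π ^ ((3 : ℝ) / 2) * (2 + ξ) * Real.Gamma (1 + ξ / 2))| < ε := by
  intro ε hε
  have hξ' := hξ
  obtain ⟨h0, h1⟩ := hξ
  set S : ℝ := ∑' n : ℕ, ((n : ℝ) + 1) ^ (-(1 + ξ)) with hS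
  -- the oscillating bounds
  have hN : ∀ j : ℤ, ∃ N : ℝ → ℝ, Filter.Tendsto N (Filter.cocompact ℝ) (nhds 0) ∧ (∀ r, 0 ≤ N r) ∧
      (∀ r, N r ≤ if j = 0 then 0 else Cm p ξ * L ^ (1 + ξ) * |(j : ℝ)| ^ (-(1 + ξ))) ∧
      (j ≠ 0 → ∀ r θ : ℝ, |∫ k, Real.cos (k * r + θ) * gm p ξ L j k| ≤ N r) := by
    intro j
    by_cases hj : j = 0
    · exact ⟨fun _ => 0, tendsto_const_nhds, fun _ => le_rfl, by simp [hj], fun h => absurd hj h⟩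
    · obtain ⟨i1, v1⟩ := gm_int p ξ L hξ' hL j hj
      obtain ⟨N, a1, a2, a3, a4⟩ := riemLeb _ i1 (gm_nonneg p ξ L hp j)
      refine ⟨N, a1, a2, ?_, fun _ => a4⟩
      rw [if_neg hj, ← v1]; exact a3
  choose N hN1 hN2 hN3 hN4 using hN
  have hbs : HasSum (fun j : ℤ => if j = 0 then 0 else Cm p ξ * L ^ (1 + ξ) * |(j : ℝ)| ^ (-(1 + ξ)))
      (Cm p ξ * L ^ (1 + ξ) * (2 * S)) := by
    have := (zsum ξ h0).mul_left (Cm p ξ * L ^ (1 + ξ))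
    simp only [mul_ite, mul_zero] at this
    exact this
  have hT : Filter.Tendsto (fun r => ∑' j, N j r) (Filter.cocompact ℝ) (nhds 0) := by
    have := tendsto_tsum_of_dominated_convergence (f := fun r j => N j r) (g := fun _ => (0:ℝ))
      hbs.summable hN1 (Filter.Eventually.of_forall fun r j => by
        rw [Real.norm_of_nonneg (hN2 j r)]; exact hN3 j r)
    simpa using this
  have hNs : ∀ r, Summable (fun j => N j r) := fun r =>
    Summable.of_nonneg_of_le (fun j => hN2 j r) (fun j => hN3 j r) hbs.summable
  have hc0 : 0 < 1 / (4 * π ^ 2 * L) := by positivity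
  have hev : ∀ᶠ r in Filter.cocompact ℝ, ∑' j, N j r < ε / (1 / (4 * π ^ 2 * L)) :=
    hT.eventually (gt_mem_nhds (by positivity))
  rw [← Metric.cobounded_eq_cocompact, ← comap_norm_atTop, Filter.eventually_comap,
    Filter.eventually_atTop] at hev
  obtain ⟨M, hM⟩ := hev
  refine ⟨max M 1, fun r₁ r₂ hr _ => ?_⟩
  have hr0 : r₁ ≠ 0 := abs_pos.1 (lt_of_lt_of_le one_pos ((le_max_right _ _).trans hr))
  have hsmall := hM |r₁| ((le_max_left _ _).trans hr) r₁ rfl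
  set T : ℤ → ℝ := fun j => if j = 0 then 0 else
    ∫ k, Real.cos (k * r₁ + (j : ℝ) / L * r₂) * gm p ξ L j k with hTdef
  have hTN : ∀ j, ‖T j‖ ≤ N j r₁ := by
    intro j
    by_cases hj : j = 0
    · simp [hTdef, hj, hN2]
    · simp only [hTdef, if_neg hj]; exact hN4 j hj r₁ _
  have hTs : Summable T := Summable.of_norm_bounded (hNs r₁) hTN
  have hTle : |∑' j, T j| ≤ ∑' j, N j r₁ := tsum_of_norm_bounded (hNs r₁).hasSum hTN
  set Z : ℝ := (1 - p) * (√π * |Gamma (-(1 + ξ) / 2)| / (2 ^ (1 + ξ) * Gamma (1 + ξ / 2)) *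
    |r₁| ^ (1 + ξ)) with hZ
  have hf : ∀ j : ℤ, (∫ k₁ : ℝ, (1 - Real.cos (k₁ * r₁ + (j : ℝ) / L * r₂)) *
      Acyl p k₁ ((j : ℝ) / L) 1 1 * (k₁ ^ 2 + (j : ℝ) ^ 2 / L ^ 2) ^ (-(2 + ξ) / 2)) =
      (if j = 0 then Z else 0) +
      ((if j = 0 then 0 else Cm p ξ * L ^ (1 + ξ) * |(j : ℝ)| ^ (-(1 + ξ))) - T j) := by
    intro j
    by_cases hj : j = 0
    · subst hj
      simp only [hTdef, if_true, sub_self, add_zero, hZ]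
      rw [← zeroMode ξ r₁ h0 h1 hr0, ← integral_const_mul]
      congr 1; ext k
      simp [Acyl]
      ring
    · obtain ⟨i1, v1⟩ := gm_int p ξ L hξ' hL j hj
      simp only [hTdef, if_neg hj, zero_add]
      rw [← v1, ← integral_sub i1]
      · congr 1; ext k; unfold gm; ring
      · refine i1.mono (by
          refine AEStronglyMeasurable.mul ?_ i1.aestronglyMeasurable
          exact (by fun_prop : Continuous fun k : ℝ => Real.cos (k * r₁ + (j : ℝ) / L * r₂)).aestronglyMeasurable)
          (Filter.Eventually.of_forall fun k => ?_)
        rw [norm_mul]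
        exact mul_le_of_le_one_left (norm_nonneg _) (abs_cos_le_one _)
  have hsum : HasSum (fun j : ℤ => (if j = 0 then Z else 0) +
      ((if j = 0 then 0 else Cm p ξ * L ^ (1 + ξ) * |(j : ℝ)| ^ (-(1 + ξ))) - T j))
      (Z + (Cm p ξ * L ^ (1 + ξ) * (2 * S) - ∑' j, T j)) :=
    (hasSum_ite_eq 0 Z).add (hbs.sub hTs.hasSum)
  have hd : dcov p ξ L 1 1 (r₁, r₂) = 1 / (4 * π ^ 2 * L) *
      (Z + (Cm p ξ * L ^ (1 + ξ) * (2 * S) - ∑' j, T j)) := by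
    unfold dcov
    simp only [hf, hsum.tsum_eq]
  have hpi : π ^ ((3 : ℝ) / 2) = π * √π := by
    rw [Real.sqrt_eq_rpow, show (3:ℝ) / 2 = 1 + 1 / 2 by norm_num, Real.rpow_add pi_pos, rpow_one]
  have hsq : π = √π * √π := (Real.mul_self_sqrt pi_pos.le).symm
  have hspos : 0 < √π := Real.sqrt_pos.2 pi_pos
  have hGp : 0 < Gamma (1 + ξ / 2) := Real.Gamma_pos_of_pos (by linarith)
  have e1 : (1 - p) * |Real.Gamma (-(1 + ξ) / 2)| /
            ((2 : ℝ) ^ (3 + ξ) * π ^ ((3 : ℝ) / 2) * Real.Gamma (1 + ξ / 2) * L) *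
            |r₁| ^ (1 + ξ) = 1 / (4 * π ^ 2 * L) * Z := by
    rw [hZ, hpi, show (3:ℝ) + ξ = 2 + (1 + ξ) by ring, Real.rpow_add two_pos, Real.rpow_two]
    have : (2:ℝ) ^ (1 + ξ) ≠ 0 := (rpow_pos_of_pos two_pos _).ne'
    generalize √π = s at *
    rw [hsq]
    field_simp
    try ring
  have e2 : (1 + p * ξ) * L ^ ξ * Real.Gamma ((1 + ξ) / 2) * S /
          (2 * π ^ ((3 : ℝ) / 2) * (2 + ξ) * Real.Gamma (1 + ξ / 2)) =
      1 / (4 * π ^ 2 * L) * (Cm p ξ * L ^ (1 + ξ) * (2 * S)) := by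
    rw [hpi, Real.rpow_add hL, rpow_one, Cm]
    have : 2 + ξ ≠ 0 := by linarith
    generalize √π = s at *
    rw [hsq]
    field_simp
    try ring
  rw [hd, e1, e2]
  rw [show 1 / (4 * π ^ 2 * L) * (Z + (Cm p ξ * L ^ (1 + ξ) * (2 * S) - ∑' j, T j)) -
    1 / (4 * π ^ 2 * L) * Z - 1 / (4 * π ^ 2 * L) * (Cm p ξ * L ^ (1 + ξ) * (2 * S)) =
    -(1 / (4 * π ^ 2 * L) * ∑' j, T j) by ring, abs_neg, abs_mul, abs_of_pos hc0]
  rw [lt_div_iff₀ hc0] at hsmall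
  calc _ ≤ 1 / (4 * π ^ 2 * L) * ∑' j, N j r₁ := by gcongr
    _ < ε := by linarith
end

section
/- Fix ξ ∈ (0,1), ℘ ∈ [0,1], and L > 0. The off-diagonal covariance of velocity differences vanishes at large axial separation: d₁₂(r) → 0 as |r₁| → ∞, uniformly in r₂ ∈ [−πL, πL). -/
open MeasureTheory Real

/-- the off-diagonal kernel -/
noncomputable def fker (p ξ q k : ℝ) : ℝ :=
  ((2 * p - 1) * (k * q) / (k ^ 2 + q ^ 2)) * (k ^ 2 + q ^ 2) ^ (-(2 + ξ) / 2)

lemma fker_neg (p ξ q k : ℝ) : fker p ξ q (-k) = - fker p ξ q k := by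
  unfold fker
  rw [neg_sq]; ring

lemma fker_zero (p ξ k : ℝ) : fker p ξ 0 k = 0 := by
  unfold fker; simp

lemma fker_int_zero (p ξ q : ℝ) : ∫ k, fker p ξ q k = 0 := by
  have h := integral_neg_eq_self (fun k => fker p ξ q k) volume
  simp only [fker_neg, integral_neg] at h
  linarith

lemma fker_bound (p ξ q k : ℝ) (hξ : 0 < ξ) (hp : p ∈ Set.Icc (0 : ℝ) 1) (hq : q ≠ 0) :
    |fker p ξ q k| ≤ |q| ^ (-ξ) * (q ^ 2)⁻¹ * (1 + (k / q) ^ 2)⁻¹ := by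
  obtain ⟨h0, h1⟩ := hp
  have hq2 : 0 < q ^ 2 := by positivity
  have hs : 0 < k ^ 2 + q ^ 2 := by positivity
  have e1 : (q ^ 2)⁻¹ * (1 + (k / q) ^ 2)⁻¹ = (k ^ 2 + q ^ 2)⁻¹ := by
    rw [← mul_inv]; congr 1; field_simp; ring
  have e2 : (k ^ 2 + q ^ 2) ^ (-(2 + ξ) / 2) = (k ^ 2 + q ^ 2) ^ (-ξ / 2) * (k ^ 2 + q ^ 2)⁻¹ := by
    rw [← Real.rpow_neg_one, ← Real.rpow_add hs]; congr 1; ring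
  have e3 : (k ^ 2 + q ^ 2) ^ (-ξ / 2) ≤ |q| ^ (-ξ) := by
    have : |q| ^ (-ξ) = (q ^ 2) ^ (-ξ / 2) := by
      rw [← sq_abs, ← Real.rpow_natCast, ← Real.rpow_mul (abs_nonneg q)]
      congr 1; push_cast; ring
    rw [this]
    exact Real.rpow_le_rpow_of_nonpos hq2 (by nlinarith [sq_nonneg k]) (by linarith)
  have e4 : |(2 * p - 1) * (k * q) / (k ^ 2 + q ^ 2)| ≤ 1 := by
    rw [abs_div, abs_of_pos hs, div_le_one hs, abs_mul]
    have a1 : |2 * p - 1| ≤ 1 := abs_le.2 ⟨by linarith, by linarith⟩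
    have a2 : |k * q| ≤ k ^ 2 + q ^ 2 :=
      abs_le.2 ⟨by nlinarith [sq_nonneg (k + q)], by nlinarith [sq_nonneg (k - q)]⟩
    calc _ ≤ 1 * |k * q| := by gcongr
      _ ≤ _ := by linarith
  unfold fker
  rw [mul_assoc, e1, abs_mul, e2]
  rw [abs_of_nonneg (a := (k ^ 2 + q ^ 2) ^ (-ξ / 2) * (k ^ 2 + q ^ 2)⁻¹) (by positivity)]
  calc _ ≤ 1 * ((k ^ 2 + q ^ 2) ^ (-ξ / 2) * (k ^ 2 + q ^ 2)⁻¹) := by gcongr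
    _ ≤ _ := by rw [one_mul]; gcongr

lemma fker_meas (p ξ q : ℝ) : Measurable (fker p ξ q) := by
  unfold fker; fun_prop

lemma dom_integrable (c q : ℝ) (hq : q ≠ 0) :
    Integrable (fun k : ℝ => c * (1 + (k / q) ^ 2)⁻¹) :=
  (integrable_inv_one_add_sq.comp_div hq).const_mul c

lemma fker_integrable (p ξ q : ℝ) (hξ : 0 < ξ) (hp : p ∈ Set.Icc (0 : ℝ) 1) :
    Integrable (fker p ξ q) := by
  by_cases hq : q = 0
  · subst hq
    have : fker p ξ 0 = fun _ => 0 := funext (fker_zero p ξ)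
    rw [this]; exact integrable_zero _ _ _
  · exact (dom_integrable _ q hq).mono' (fker_meas p ξ q).aestronglyMeasurable
      (Filter.Eventually.of_forall fun k => fker_bound p ξ q k hξ hp hq)

lemma fker_L1 (p ξ q : ℝ) (hξ : 0 < ξ) (hp : p ∈ Set.Icc (0 : ℝ) 1) :
    ∫ k, |fker p ξ q k| ≤ π * |q| ^ (-(1 + ξ)) := by
  by_cases hq : q = 0
  · subst hq
    simp only [fker_zero, abs_zero, integral_zero]
    positivity
  · have h := integral_mono (fker_integrable p ξ q hξ hp).abs (dom_integrable _ q hq)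
      (fun k => fker_bound p ξ q k hξ hp hq)
    refine h.trans (le_of_eq ?_)
    have h2 := Measure.integral_comp_div (fun x : ℝ => (1 + x ^ 2)⁻¹) q
    rw [integral_const_mul, h2, integral_univ_inv_one_add_sq, smul_eq_mul]
    have hq' : 0 < |q| := abs_pos.2 hq
    rw [neg_add, Real.rpow_add hq', Real.rpow_neg_one, ← sq_abs q]
    field_simp

/-- modulus of the Fourier transform of the kernel -/
noncomputable def Gker (p ξ q w : ℝ) : ℝ :=
  ‖∫ v : ℝ, Real.fourierChar (-(v * w)) • ((fker p ξ q v : ℝ) : ℂ)‖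

lemma Gker_nonneg (p ξ q w : ℝ) : 0 ≤ Gker p ξ q w := norm_nonneg _

lemma Gker_le (p ξ q w : ℝ) (hξ : 0 < ξ) (hp : p ∈ Set.Icc (0 : ℝ) 1) :
    Gker p ξ q w ≤ π * |q| ^ (-(1 + ξ)) := by
  refine le_trans ?_ (fker_L1 p ξ q hξ hp)
  unfold Gker
  refine (norm_integral_le_integral_norm _).trans (le_of_eq ?_)
  congr 1; ext v
  rw [Circle.norm_smul, Complex.norm_real, Real.norm_eq_abs]

lemma term_le (p ξ q r₁ r₂ : ℝ) (hξ : 0 < ξ) (hp : p ∈ Set.Icc (0 : ℝ) 1) :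
    |∫ k, (1 - Real.cos (k * r₁ + q * r₂)) * fker p ξ q k| ≤ Gker p ξ q (-r₁ / (2 * π)) := by
  have hi := fker_integrable p ξ q hξ hp
  have hc : Integrable (fun k => Real.cos (k * r₁ + q * r₂) * fker p ξ q k) :=
    hi.bdd_mul (c := 1) (by fun_prop)
      (Filter.Eventually.of_forall fun k => by
        rw [Real.norm_eq_abs]; exact Real.abs_cos_le_one _)
  have hE : Integrable (fun v : ℝ => Complex.exp (((v * r₁ + q * r₂ : ℝ) : ℂ) * Complex.I) *
      ((fker p ξ q v : ℝ) : ℂ)) :=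
    (hi.ofReal (𝕜 := ℂ)).bdd_mul (c := 1) (by fun_prop)
      (Filter.Eventually.of_forall fun k => by rw [Complex.norm_exp_ofReal_mul_I])
  have e1 : ∫ k, (1 - Real.cos (k * r₁ + q * r₂)) * fker p ξ q k
      = - ∫ k, Real.cos (k * r₁ + q * r₂) * fker p ξ q k := by
    simp only [sub_mul, one_mul]
    rw [integral_sub hi hc, fker_int_zero, zero_sub]
  have e2 : ∫ k, Real.cos (k * r₁ + q * r₂) * fker p ξ q k
      = (∫ v : ℝ, Complex.exp (((v * r₁ + q * r₂ : ℝ) : ℂ) * Complex.I) *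
      ((fker p ξ q v : ℝ) : ℂ)).re := by
    have := integral_re hE
    simp only [RCLike.re_eq_complex_re] at this
    rw [← this]
    congr 1; ext k
    rw [Complex.re_mul_ofReal, Complex.exp_ofReal_mul_I_re]
  have e3 : ∫ v : ℝ, Complex.exp (((v * r₁ + q * r₂ : ℝ) : ℂ) * Complex.I) *
      ((fker p ξ q v : ℝ) : ℂ) = Complex.exp (((q * r₂ : ℝ) : ℂ) * Complex.I) *
      ∫ v : ℝ, Real.fourierChar (-(v * (-r₁ / (2 * π)))) • ((fker p ξ q v : ℝ) : ℂ) := by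
    rw [← integral_const_mul]
    congr 1; ext v
    rw [Circle.smul_def, smul_eq_mul, Real.fourierChar_apply, ← mul_assoc, ← Complex.exp_add]
    congr 2
    have : 2 * π * -(v * (-r₁ / (2 * π))) = v * r₁ := by field_simp
    rw [this]; push_cast; ring
  rw [e1, abs_neg, e2, e3]
  refine (Complex.abs_re_le_norm _).trans (le_of_eq ?_)
  rw [norm_mul, Complex.norm_exp_ofReal_mul_I, one_mul, Gker]

lemma Gker_tendsto (p ξ q : ℝ) :
    Filter.Tendsto (Gker p ξ q) (Filter.cocompact ℝ) (nhds 0) := by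
  have h := (Real.tendsto_integral_exp_smul_cocompact (fun v : ℝ => ((fker p ξ q v : ℝ) : ℂ))).norm
  rw [norm_zero] at h
  exact h

lemma dom_summable (ξ L : ℝ) (hξ : 0 < ξ) :
    Summable (fun j : ℤ => π * |(j : ℝ) / L| ^ (-(1 + ξ))) := by
  have h := (Real.summable_abs_int_rpow (b := 1 + ξ) (by linarith)).mul_right
    ((|L| ^ (-(1 + ξ)))⁻¹)
  refine (h.mul_left π).congr fun j => ?_
  rw [abs_div, Real.div_rpow (abs_nonneg _) (abs_nonneg _), div_eq_mul_inv]

/-- For `ξ ∈ (0,1)`, `℘ ∈ [0,1]`, `L > 0`, the off-diagonal covariance of velocity differences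
vanishes at large axial separation: `d₁₂(r) → 0` as `|r₁| → ∞`, uniformly in `r₂ ∈ [−πL, πL)`. -/
theorem stmt_12 (ξ p L : ℝ) (hξ : ξ ∈ Set.Ioo (0 : ℝ) 1) (hp : p ∈ Set.Icc (0 : ℝ) 1)
    (hL : 0 < L) :
    ∀ ε : ℝ, 0 < ε → ∃ M : ℝ, ∀ r₁ r₂ : ℝ, M ≤ |r₁| → r₂ ∈ Set.Ico (-(π * L)) (π * L) →
      |dcov p ξ L 0 1 (r₁, r₂)| < ε := by
  intro ε hε
  have hξ0 := hξ.1
  have hT : Filter.Tendsto (fun w => ∑' j : ℤ, Gker p ξ ((j : ℝ) / L) w) (Filter.cocompact ℝ)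
      (nhds (∑' j : ℤ, (0 : ℝ))) :=
    tendsto_tsum_of_dominated_convergence (dom_summable ξ L hξ0)
      (fun j => Gker_tendsto p ξ _)
      (Filter.Eventually.of_forall fun w j => by
        rw [Real.norm_eq_abs, abs_of_nonneg (Gker_nonneg _ _ _ _)]
        exact Gker_le p ξ _ w hξ0 hp)
  rw [tsum_zero] at hT
  have hC : 0 < 4 * π ^ 2 * L := by positivity
  have hev := hT.eventually (gt_mem_nhds (show 0 < ε * (4 * π ^ 2 * L) by positivity))
  rw [← Metric.cobounded_eq_cocompact, ← comap_norm_atTop, Filter.eventually_comap,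
    Filter.eventually_atTop] at hev
  obtain ⟨N, hN⟩ := hev
  refine ⟨N * (2 * π), fun r₁ r₂ hr _ => ?_⟩
  have hw := hN (|r₁| / (2 * π)) ((le_div_iff₀ (by positivity)).2 hr) (-r₁ / (2 * π))
    (by rw [Real.norm_eq_abs, abs_div, abs_neg, abs_of_pos (show 0 < 2 * π by positivity)])
  have hterm : ∀ j : ℤ, ∫ k₁ : ℝ,
      (1 - Real.cos (k₁ * r₁ + (j : ℝ) / L * r₂)) * Acyl p k₁ ((j : ℝ) / L) 0 1 *
      (k₁ ^ 2 + (j : ℝ) ^ 2 / L ^ 2) ^ (-(2 + ξ) / 2)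
      = ∫ k, (1 - Real.cos (k * r₁ + (j : ℝ) / L * r₂)) * fker p ξ ((j : ℝ) / L) k := by
    intro j
    congr 1; ext k
    rw [← div_pow]
    simp [Acyl, fker, mul_assoc]
  have hGs : Summable (fun j : ℤ => Gker p ξ ((j : ℝ) / L) (-r₁ / (2 * π))) :=
    Summable.of_nonneg_of_le (fun _ => Gker_nonneg _ _ _ _)
      (fun j => Gker_le p ξ _ _ hξ0 hp) (dom_summable ξ L hξ0)
  have hsum := tsum_of_norm_bounded
    (f := fun j : ℤ => ∫ k, (1 - Real.cos (k * r₁ + (j : ℝ) / L * r₂)) * fker p ξ ((j : ℝ) / L) k)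
    hGs.hasSum
    (fun j : ℤ => term_le p ξ ((j : ℝ) / L) r₁ r₂ hξ0 hp)
  unfold dcov
  simp only [hterm]
  rw [abs_mul, abs_of_pos (by positivity), one_div, inv_mul_lt_iff₀ hC, mul_comm _ ε]
  exact lt_of_le_of_lt hsum hw
end

section
/- Fix c > 0 and h ∈ (0,1), and define v: ℝ → ℝ by v(x) = [h(h+1)c⁴ + 2(1−h²)c²x² − h(1−h)x⁴] / (4(1−h)c^{2(h+1)}) for |x| ≤ c and v(x) = |x|^{2(1−h)}/(2(1−h)) for |x| > c. Then v is non-negative, twice continuously differentiable on ℝ, and its second derivative satisfies v''(x) = (1−2h)|x|^{−2h} for |x| > c. -/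
open Real

/-- The one-dimensional profile of the Lyapunov function used to control the axial component of
the two-particle separation: `v(x) = [h(h+1)c⁴ + 2(1−h²)c²x² − h(1−h)x⁴]/(4(1−h)c^{2(h+1)})`
for `|x| ≤ c` and `v(x) = |x|^{2(1−h)}/(2(1−h))` for `|x| > c`. -/
noncomputable def vLyap (c h x : ℝ) : ℝ :=
  if |x| ≤ c then
    (h * (h + 1) * c ^ 4 + 2 * (1 - h ^ 2) * c ^ 2 * x ^ 2 - h * (1 - h) * x ^ 4) /
      (4 * (1 - h) * c ^ (2 * (h + 1)))
  else |x| ^ (2 * (1 - h)) / (2 * (1 - h))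

theorem glue_hasDerivAt (c : ℝ) (P P' Q Q' : ℝ → ℝ) (hc : 0 < c)
    (hP : ∀ x, HasDerivAt P (P' x) x) (hQ : ∀ x, x ≠ 0 → HasDerivAt Q (Q' x) x)
    (h0 : ∀ x, |x| = c → P x = Q x) (h1 : ∀ x, |x| = c → P' x = Q' x) (x : ℝ) :
    HasDerivAt (fun x => if |x| ≤ c then P x else Q x) (if |x| ≤ c then P' x else Q' x) x := by
  rcases lt_trichotomy |x| c with hx | hx | hx
  · rw [if_pos hx.le]
    refine (hP x).congr_of_eventuallyEq ?_
    filter_upwards [continuous_abs.continuousAt.eventually_lt_const hx] with y hy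
    rw [if_pos (le_of_lt hy)]
  · rw [if_pos hx.le]
    have hx0 : x ≠ 0 := by
      rintro rfl
      simp at hx
      linarith
    have hA : HasDerivWithinAt (fun x => if |x| ≤ c then P x else Q x) (P' x) {y | |y| ≤ c} x := by
      refine (hP x).hasDerivWithinAt.congr (fun y hy => ?_) ?_
      · exact if_pos hy
      · exact if_pos hx.le
    have hB : HasDerivWithinAt (fun x => if |x| ≤ c then P x else Q x) (P' x) {y | c ≤ |y|} x := by
      rw [h1 x hx]
      have key : ∀ y : ℝ, c ≤ |y| → (if |y| ≤ c then P y else Q y) = Q y := by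
        intro y hy
        split_ifs with h
        · exact h0 y (le_antisymm h hy)
        · rfl
      exact (hQ x hx0).hasDerivWithinAt.congr (fun y hy => key y hy) (key x hx.ge)
    have hU := hA.union hB
    have : {y : ℝ | |y| ≤ c} ∪ {y | c ≤ |y|} = Set.univ := by
      ext y
      simpa using le_total |y| c
    rw [this] at hU
    exact hasDerivWithinAt_univ.1 hU
  · rw [if_neg hx.not_ge]
    have hx0 : x ≠ 0 := by
      rintro rfl
      simp at hx
      linarith
    refine (hQ x hx0).congr_of_eventuallyEq ?_
    filter_upwards [continuous_abs.continuousAt.eventually_const_lt hx] with y hy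
    rw [if_neg (not_le.2 hy)]

theorem abs_rpow_hasDerivAt (p x : ℝ) (hx : x ≠ 0) :
    HasDerivAt (fun x : ℝ => |x| ^ p) (p * x * |x| ^ (p - 2)) x := by
  have ha : 0 < |x| := abs_pos.2 hx
  have h := (hasDerivAt_abs hx).rpow_const (p := p) (Or.inl ha.ne')
  convert h using 1
  have e : |x| ^ (p - 1) = |x| ^ (p - 2) * |x| := by
    rw [← Real.rpow_add_one ha.ne']; ring_nf
  rw [e]
  have : (SignType.sign x : ℝ) * |x| = x := sign_mul_abs x
  linear_combination (-p * |x| ^ (p - 2)) * this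

/-- For `c > 0` and `h ∈ (0,1)`, the Lyapunov profile `v` is non-negative, twice continuously
differentiable on `ℝ`, and its second derivative satisfies `v''(x) = (1−2h)|x|^{−2h}` for
`|x| > c`. -/
theorem stmt_15 (c h : ℝ) (hc : 0 < c) (hh : h ∈ Set.Ioo (0 : ℝ) 1) :
    (∀ x : ℝ, 0 ≤ vLyap c h x) ∧
    ContDiff ℝ 2 (vLyap c h) ∧
    ∀ x : ℝ, c < |x| → deriv (deriv (vLyap c h)) x = (1 - 2 * h) * |x| ^ (-(2 * h)) := by
  obtain ⟨hh0, hh1⟩ := hh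
  have hk : 0 < 1 - h := by linarith
  have hk' : 1 - h ≠ 0 := hk.ne'
  set K : ℝ := c ^ (2 * (h + 1)) with hK
  have hKpos : 0 < K := Real.rpow_pos_of_pos hc _
  set M : ℝ := c ^ (-(2 * h)) with hM
  have hKM : K * M = c ^ 2 := by
    rw [hK, hM, ← Real.rpow_add hc, ← Real.rpow_natCast]
    congr 1
    push_cast
    ring
  have hcM : c ^ (2 * (1 - h)) = c ^ 2 * M := by
    rw [hM, ← Real.rpow_natCast c 2, ← Real.rpow_add hc]
    congr 1
    push_cast
    ring
  have d1 : ∀ x, HasDerivAt (vLyap c h)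
      (if |x| ≤ c then ((1 + h) * c ^ 2 * x - h * x ^ 3) / K else x * |x| ^ (-(2 * h))) x := by
    intro x
    refine glue_hasDerivAt c (fun x => (h * (h + 1) * c ^ 4 + 2 * (1 - h ^ 2) * c ^ 2 * x ^ 2
      - h * (1 - h) * x ^ 4) / (4 * (1 - h) * K)) (fun x => ((1 + h) * c ^ 2 * x - h * x ^ 3) / K)
      (fun x => |x| ^ (2 * (1 - h)) / (2 * (1 - h))) (fun x => x * |x| ^ (-(2 * h)))
      hc ?_ ?_ ?_ ?_ x
    · intro x
      have := ((((hasDerivAt_pow 2 x).const_mul (2 * (1 - h ^ 2) * c ^ 2)).const_add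
        (h * (h + 1) * c ^ 4)).sub ((hasDerivAt_pow 4 x).const_mul (h * (1 - h)))).div_const
        (4 * (1 - h) * K)
      refine this.congr_deriv ?_
      push_cast
      field_simp
      ring
    · intro x hx
      refine ((abs_rpow_hasDerivAt (2 * (1 - h)) x hx).div_const (2 * (1 - h))).congr_deriv ?_
      rw [show 2 * (1 - h) - 2 = -(2 * h) by ring]
      field_simp
    · intro x hx
      have hx2 : x ^ 2 = c ^ 2 := by rw [← hx, sq_abs]
      have hx4 : x ^ 4 = c ^ 4 := by linear_combination (x ^ 2 + c ^ 2) * hx2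
      simp only [hx, hx2, hx4, hcM]
      field_simp
      linear_combination (-4) * hKM
    · intro x hx
      have hx2 : x ^ 2 = c ^ 2 := by rw [← hx, sq_abs]
      simp only [hx]
      rw [div_eq_iff hKpos.ne']
      linear_combination (-h * x) * hx2 - x * hKM
  have e1 := funext fun x => (d1 x).deriv
  have d2 : ∀ x, HasDerivAt (deriv (vLyap c h))
      (if |x| ≤ c then ((1 + h) * c ^ 2 - 3 * h * x ^ 2) / K
        else (1 - 2 * h) * |x| ^ (-(2 * h))) x := by
    intro x
    rw [e1]
    refine glue_hasDerivAt c (fun x => ((1 + h) * c ^ 2 * x - h * x ^ 3) / K)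
      (fun x => ((1 + h) * c ^ 2 - 3 * h * x ^ 2) / K)
      (fun x => x * |x| ^ (-(2 * h))) (fun x => (1 - 2 * h) * |x| ^ (-(2 * h)))
      hc ?_ ?_ ?_ ?_ x
    · intro x
      have := (((hasDerivAt_id x).const_mul ((1 + h) * c ^ 2)).sub
        ((hasDerivAt_pow 3 x).const_mul h)).div_const K
      refine this.congr_deriv ?_
      push_cast
      ring
    · intro x hx
      refine ((hasDerivAt_id x).mul (abs_rpow_hasDerivAt (-(2 * h)) x hx)).congr_deriv ?_
      have ha : 0 < |x| := abs_pos.2 hx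
      have e : |x| ^ (-(2 * h)) = |x| ^ (-(2 * h) - 2) * x ^ 2 := by
        rw [← sq_abs x, ← Real.rpow_natCast |x| 2, ← Real.rpow_add ha]
        congr 1
        push_cast
        ring
      simp only [id]
      rw [e]
      ring
    · intro x hx
      have hx2 : x ^ 2 = c ^ 2 := by rw [← hx, sq_abs]
      simp only [hx]
      rw [div_eq_iff hKpos.ne']
      linear_combination (-h * x) * hx2 - x * hKM
    · intro x hx
      have hx2 : x ^ 2 = c ^ 2 := by rw [← hx, sq_abs]
      simp only [hx]
      rw [div_eq_iff hKpos.ne']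
      linear_combination (-3 * h) * hx2 - (1 - 2 * h) * hKM
  have e2 := funext fun x => (d2 x).deriv
  refine ⟨?_, ?_, ?_⟩
  · intro x
    unfold vLyap
    split_ifs with hx
    · have hx2 : x ^ 2 ≤ c ^ 2 := sq_le_sq' (abs_le.1 hx).1 (abs_le.1 hx).2
      apply div_nonneg _ (by positivity)
      have a1 : 0 ≤ h * (h + 1) * c ^ 4 := by positivity
      have a2 : 0 ≤ (1 - h) * h * x ^ 2 * (c ^ 2 - x ^ 2) :=
        mul_nonneg (by positivity) (by linarith)
      have a3 : 0 ≤ (1 - h) * (2 + h) * c ^ 2 * x ^ 2 := by positivity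
      linarith
    · positivity
  · rw [show (2 : WithTop ℕ∞) = 1 + 1 by norm_num, contDiff_succ_iff_deriv]
    refine ⟨fun x => (d1 x).differentiableAt, by simp, ?_⟩
    rw [contDiff_one_iff_deriv]
    refine ⟨fun x => (d2 x).differentiableAt, ?_⟩
    rw [e2]
    refine continuous_if_le continuous_abs continuous_const ?_ ?_ ?_
    · fun_prop
    · intro x hx
      have hx : c ≤ |x| := hx
      refine (ContinuousAt.mul continuousAt_const
        (continuous_abs.continuousAt.rpow_const (Or.inl ?_))).continuousWithinAt
      linarith
    · intro x hx
      have hx2 : x ^ 2 = c ^ 2 := by rw [← hx, sq_abs]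
      simp only [hx]
      rw [div_eq_iff hKpos.ne']
      linear_combination (-3 * h) * hx2 - (1 - 2 * h) * hKM
  · intro x hx
    rw [(d2 x).deriv, if_neg hx.not_ge]
end
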